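/- arXiv:1212.3121 — 7 statements merged into one kernel-verified Lean document; each statement's English description precedes it below -/
import Mathlib

section
/- For every n ≥ 1, the function m_n is differentiable on ℝ and its derivative satisfies m_n′(t) = Σ_{j=1}^{n} C(n,j) · c_j · m_{n−j}(t) for all t ∈ ℝ. -/
open MeasureTheory ProbabilityTheory Filter

/-- Moment functions `m_n(t)` defined recursively from the cumulant sequence `c`:
`m_0(t) = 1`, `m_{n+1}(t) = t * Σ_{j=0}^n C(n,j) c_{j+1} m_{n-j}(t)`. -/
noncomputable def mo (c : ℕ → ℝ) : ℕ → ℝ → ℝ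
  | 0 => fun _ => 1
  | n + 1 => fun t =>
      t * ∑ j ∈ Finset.range (n + 1), (n.choose j : ℝ) * c (j + 1) * mo c (n - j) t
  decreasing_by omega

/-- The polynomial martingales `M_n(x,t) = Σ_{j=0}^n C(n,j) m_{n-j}(-t) x^j`. -/
noncomputable def Mp (c : ℕ → ℝ) (n : ℕ) (x t : ℝ) : ℝ :=
  ∑ j ∈ Finset.range (n + 1), (n.choose j : ℝ) * mo c (n - j) (-t) * x ^ j

/-- `X` is a real-valued Lévy process under `P`: starts at `0` a.s., has stationary
increments, and independent increments over any increasing sequence of times. -/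
structure IsLevy {Ω : Type*} [MeasurableSpace Ω] (P : Measure Ω) (X : ℝ → Ω → ℝ) : Prop where
  measurable : ∀ t : ℝ, Measurable (X t)
  init : ∀ᵐ ω ∂P, X 0 ω = 0
  stationary : ∀ s t : ℝ, 0 ≤ s → s ≤ t →
    Measure.map (fun ω => X t ω - X s ω) P = Measure.map (X (t - s)) P
  indep : ∀ (m : ℕ) (ts : Fin (m + 1) → ℝ), (∀ i, 0 ≤ ts i) → Monotone ts →
    iIndepFun (m := fun _ : Fin m => (inferInstance : MeasurableSpace ℝ))
      (fun i ω => X (ts i.succ) ω - X (ts i.castSucc) ω) P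

/-- The σ-algebra `F_{≤ s} = σ(X_u : 0 ≤ u ≤ s)`. -/
def filtLE {Ω : Type*} [MeasurableSpace Ω] (X : ℝ → Ω → ℝ) (s : ℝ) : MeasurableSpace Ω :=
  ⨆ u ∈ Set.Icc (0 : ℝ) s, MeasurableSpace.comap (X u) inferInstance

/-- The σ-algebra `F_{≥ t} = σ(X_u : u ≥ t)`. -/
def filtGE {Ω : Type*} [MeasurableSpace Ω] (X : ℝ → Ω → ℝ) (t : ℝ) : MeasurableSpace Ω :=
  ⨆ u ∈ Set.Ici t, MeasurableSpace.comap (X u) inferInstance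

theorem choose_swap (n j i : ℕ) :
    n.choose j * (n - j).choose i = n.choose i * (n - i).choose j := by
  by_cases h : i + j ≤ n
  · have h1 := Nat.choose_mul (n := n) (k := i + j) (s := j) (by omega)
    have h2 := Nat.choose_mul (n := n) (k := i + j) (s := i) (by omega)
    rw [Nat.add_sub_cancel] at h1
    rw [Nat.add_sub_cancel_left] at h2
    rw [← h1, ← h2, Nat.choose_symm_add]
  · have e1 : n.choose j * (n - j).choose i = 0 := by
      by_cases hj : n < j
      · rw [Nat.choose_eq_zero_of_lt hj, zero_mul]
      · rw [Nat.choose_eq_zero_of_lt (show n - j < i by omega), mul_zero]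
    have e2 : n.choose i * (n - i).choose j = 0 := by
      by_cases hj : n < i
      · rw [Nat.choose_eq_zero_of_lt hj, zero_mul]
      · rw [Nat.choose_eq_zero_of_lt (show n - i < j by omega), mul_zero]
    rw [e1, e2]

theorem mo_succ_ext (c : ℕ → ℝ) (n N : ℕ) (h : n + 1 ≤ N) (t : ℝ) :
    mo c (n + 1) t
      = t * ∑ j ∈ Finset.range N, (n.choose j : ℝ) * c (j + 1) * mo c (n - j) t := by
  rw [mo]
  beta_reduce
  congr 1
  apply Finset.sum_subset (Finset.range_mono h)
  intro j _ hj
  rw [Finset.mem_range] at hj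
  rw [Nat.choose_eq_zero_of_lt (by omega)]
  simp

theorem mo_deriv (c : ℕ → ℝ) (n : ℕ) : ∀ (N : ℕ) (_ : n ≤ N) (t : ℝ),
    HasDerivAt (mo c n)
      (∑ i ∈ Finset.range N, (n.choose (i + 1) : ℝ) * c (i + 1) * mo c (n - (i + 1)) t) t := by
  induction n using Nat.strong_induction_on with
  | _ n ih =>
  intro N hN t
  cases n with
  | zero =>
    have : mo c 0 = fun _ => 1 := by rw [mo]
    simpa [this] using hasDerivAt_const t (1 : ℝ)
  | succ n =>
    have hf : mo c (n + 1) = fun t =>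
        t * ∑ j ∈ Finset.range N, (n.choose j : ℝ) * c (j + 1) * mo c (n - j) t := by
      funext s
      exact mo_succ_ext c n N hN s
    have hs : HasDerivAt
        (fun t => ∑ j ∈ Finset.range N, (n.choose j : ℝ) * c (j + 1) * mo c (n - j) t)
        (∑ j ∈ Finset.range N, (n.choose j : ℝ) * c (j + 1) *
          ∑ i ∈ Finset.range N,
            ((n - j).choose (i + 1) : ℝ) * c (i + 1) * mo c (n - j - (i + 1)) t) t := by
      apply HasDerivAt.fun_sum
      intro j _
      exact (ih (n - j) (by omega) N (by omega) t).const_mul _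
    rw [hf]
    refine ((hasDerivAt_id' t).fun_mul hs).congr_deriv ?_
    have key : ∑ i ∈ Finset.range N, (n.choose (i + 1) : ℝ) * c (i + 1) * mo c (n - i) t
        = t * ∑ j ∈ Finset.range N, (n.choose j : ℝ) * c (j + 1) *
          ∑ i ∈ Finset.range N,
            ((n - j).choose (i + 1) : ℝ) * c (i + 1) * mo c (n - j - (i + 1)) t := by
      simp_rw [Finset.mul_sum]
      rw [Finset.sum_comm]
      apply Finset.sum_congr rfl
      intro i _
      by_cases hi : i + 1 ≤ n
      · have e : n - i = (n - (i + 1)) + 1 := by omega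
        rw [e, mo_succ_ext c (n - (i + 1)) N (by omega) t, Finset.mul_sum, Finset.mul_sum]
        apply Finset.sum_congr rfl
        intro j _
        have hc : (n.choose j : ℝ) * ((n - j).choose (i + 1) : ℝ)
            = (n.choose (i + 1) : ℝ) * ((n - (i + 1)).choose j : ℝ) := by
          exact_mod_cast choose_swap n j (i + 1)
        rw [Nat.sub_right_comm n j (i + 1)]
        linear_combination (-(t * c (j + 1) * c (i + 1) * mo c (n - (i + 1) - j) t)) * hc
      · rw [Nat.choose_eq_zero_of_lt (by omega)]
        symm
        simp only [Nat.cast_zero, zero_mul]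
        apply Finset.sum_eq_zero
        intro j _
        rw [Nat.choose_eq_zero_of_lt (by omega : n - j < i + 1)]
        simp
    rw [← key, one_mul, ← Finset.sum_add_distrib]
    symm
    apply Finset.sum_congr rfl
    intro i _
    rw [Nat.choose_succ_succ, Nat.add_sub_add_right]
    push_cast
    ring

/-- `m_n` is differentiable on ℝ with
`m_n'(t) = Σ_{j=1}^n C(n,j) c_j m_{n-j}(t)`. -/
theorem stmt_2 (c : ℕ → ℝ) (n : ℕ) (hn : 1 ≤ n) (t : ℝ) :
    HasDerivAt (mo c n)
      (∑ j ∈ Finset.Icc 1 n, (n.choose j : ℝ) * c j * mo c (n - j) t) t := by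
  have h := mo_deriv c n n le_rfl t
  convert h using 1
  rw [Finset.range_eq_Ico, Finset.sum_Ico_add'
    (fun j => (n.choose j : ℝ) * c j * mo c (n - j) t) 0 n 1]
  rfl
end

section
/- For all n ≥ 0 and all real s, t (of arbitrary sign): m_n(s+t) = Σ_{j=0}^{n} C(n,j) · m_j(s) · m_{n−j}(t). -/
open MeasureTheory ProbabilityTheory Filter

open PowerSeries in
/-- Exponential generating series. -/
noncomputable def egs (a : ℕ → ℝ) : PowerSeries ℝ := PowerSeries.mk fun n => a n / (n.factorial : ℝ)

lemma egs_coeff_mul (a b : ℕ → ℝ) (n : ℕ) :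
    PowerSeries.coeff n (egs a * egs b) =
      (∑ j ∈ Finset.range (n + 1), (n.choose j : ℝ) * a j * b (n - j)) / (n.factorial : ℝ) := by
  rw [PowerSeries.coeff_mul, Finset.Nat.sum_antidiagonal_eq_sum_range_succ_mk, Finset.sum_div]
  refine Finset.sum_congr rfl fun j hj => ?_
  have hjn : j ≤ n := by simpa [Nat.lt_succ_iff] using hj
  rw [Nat.cast_choose ℝ hjn]
  have h1 : (j.factorial : ℝ) ≠ 0 := by exact_mod_cast j.factorial_ne_zero
  have h2 : ((n - j).factorial : ℝ) ≠ 0 := by exact_mod_cast (n - j).factorial_ne_zero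
  have h3 : (n.factorial : ℝ) ≠ 0 := by exact_mod_cast n.factorial_ne_zero
  simp only [egs, PowerSeries.coeff_mk]
  field_simp

lemma egs_ode_unique (G f g : PowerSeries ℝ)
    (hf : PowerSeries.derivative ℝ f = G * f)
    (hg : PowerSeries.derivative ℝ g = G * g)
    (h0 : PowerSeries.coeff 0 f = PowerSeries.coeff 0 g) : f = g := by
  ext n
  induction n using Nat.strong_induction_on with
  | _ n ih =>
    cases n with
    | zero => exact h0
    | succ n =>
      have h1 := congrArg (PowerSeries.coeff n) hf
      have h2 := congrArg (PowerSeries.coeff n) hg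
      rw [PowerSeries.coeff_derivative, PowerSeries.coeff_mul] at h1 h2
      have h3 : ∑ p ∈ Finset.HasAntidiagonal.antidiagonal n, PowerSeries.coeff p.1 G * PowerSeries.coeff p.2 f
          = ∑ p ∈ Finset.HasAntidiagonal.antidiagonal n, PowerSeries.coeff p.1 G * PowerSeries.coeff p.2 g := by
        refine Finset.sum_congr rfl fun p hp => ?_
        have := Finset.HasAntidiagonal.mem_antidiagonal.1 hp
        rw [ih p.2 (by omega)]
      have hn : (n : ℝ) + 1 ≠ 0 := by positivity
      exact mul_right_cancel₀ hn (by rw [h1, h2, h3])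

lemma egs_mo_ode (c : ℕ → ℝ) (t : ℝ) :
    PowerSeries.derivative ℝ (egs fun n => mo c n t) =
      (PowerSeries.C t * egs fun n => c (n + 1)) * egs fun n => mo c n t := by
  ext n
  rw [mul_assoc, PowerSeries.coeff_C_mul, egs_coeff_mul, PowerSeries.coeff_derivative]
  simp only [egs, PowerSeries.coeff_mk]
  rw [mo, Nat.factorial_succ]
  have h3 : (n.factorial : ℝ) ≠ 0 := by exact_mod_cast n.factorial_ne_zero
  have hn : (n : ℝ) + 1 ≠ 0 := by positivity
  push_cast
  field_simp

/-- For all `n ≥ 0` and all real `s, t`: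
`m_n(s+t) = Σ_{j=0}^n C(n,j) m_j(s) m_{n-j}(t)`. -/
theorem stmt_3 (c : ℕ → ℝ) (n : ℕ) (s t : ℝ) :
    mo c n (s + t)
      = ∑ j ∈ Finset.range (n + 1), (n.choose j : ℝ) * mo c j s * mo c (n - j) t := by
  have key : (egs fun n => mo c n (s + t)) = (egs fun n => mo c n s) * egs fun n => mo c n t := by
    refine egs_ode_unique _ _ _ (egs_mo_ode c (s + t)) ?_ ?_
    · rw [Derivation.leibniz, egs_mo_ode, egs_mo_ode, map_add]
      simp only [smul_eq_mul]
      ring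
    · rw [egs_coeff_mul]
      simp [egs, mo]
  have h := congrArg (PowerSeries.coeff n) key
  rw [egs_coeff_mul] at h
  simp only [egs, PowerSeries.coeff_mk] at h
  have h3 : (n.factorial : ℝ) ≠ 0 := by exact_mod_cast n.factorial_ne_zero
  exact (div_left_inj' h3).1 h
end

section
/- For every n ≥ 0 and all real x, t the following polynomial identity holds: M_1(x,t) · M_n(x,t) = M_{n+1}(x,t) + t · Σ_{k=1}^{n} C(n,k) · c_{k+1} · M_{n−k}(x,t). -/
open MeasureTheory ProbabilityTheory Filter

theorem choose_aux (n j k : ℕ) (h : j + k ≤ n) :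
    n.choose j * (n - j).choose k = n.choose k * (n - k).choose j := by
  have h1 := Nat.choose_mul (n := n) (k := j + k) (s := j) (by omega)
  have h2 := Nat.choose_mul (n := n) (k := j + k) (s := k) (by omega)
  have e1 : j + k - j = k := by omega
  have e2 : j + k - k = j := by omega
  have e3 : (j + k).choose j = (j + k).choose k := Nat.choose_symm_add
  rw [e1] at h1
  rw [e2] at h2
  rw [← h1, ← h2, e3]

theorem mo_succ (c : ℕ → ℝ) (n : ℕ) (t : ℝ) : mo c (n + 1) t =
    t * ∑ j ∈ Finset.range (n + 1), (n.choose j : ℝ) * c (j + 1) * mo c (n - j) t := by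
  rw [mo]

theorem swap_aux (c : ℕ → ℝ) (n : ℕ) (x t : ℝ) :
    ∑ j ∈ Finset.range (n + 1), (n.choose j : ℝ) * mo c (n + 1 - j) (-t) * x ^ j =
    -t * ∑ k ∈ Finset.range (n + 1), (n.choose k : ℝ) * c (k + 1) * Mp c (n - k) x t := by
  have h : ∀ j ∈ Finset.range (n + 1), (n.choose j : ℝ) * mo c (n + 1 - j) (-t) * x ^ j =
      ∑ k ∈ Finset.range (n - j + 1), -t * ((n.choose j : ℝ) * ((n - j).choose k : ℝ) *
        c (k + 1) * mo c (n - j - k) (-t) * x ^ j) := by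
    intro j hj
    have : n + 1 - j = (n - j) + 1 := by
      have := Finset.mem_range.1 hj
      omega
    rw [this, mo_succ, Finset.mul_sum, Finset.mul_sum, Finset.sum_mul]
    exact Finset.sum_congr rfl fun k _ => by ring
  rw [Finset.sum_congr rfl h, Finset.mul_sum]
  simp only [Mp, Finset.mul_sum]
  rw [Finset.sum_comm' (t' := Finset.range (n + 1)) (s' := fun k => Finset.range (n - k + 1))
    (by intro a b; simp only [Finset.mem_range]; omega)]
  refine Finset.sum_congr rfl fun k hk => Finset.sum_congr rfl fun j hj => ?_
  have hk := Finset.mem_range.1 hk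
  have hj := Finset.mem_range.1 hj
  have e : (n.choose j : ℝ) * ((n - j).choose k : ℝ) = n.choose k * (n - k).choose j := by
    exact_mod_cast choose_aux n j k (by omega)
  rw [e, Nat.sub_right_comm n j k]
  ring

theorem pascal_aux (c : ℕ → ℝ) (n : ℕ) (x t : ℝ) :
    Mp c (n + 1) x t = x * Mp c n x t +
    ∑ j ∈ Finset.range (n + 1), (n.choose j : ℝ) * mo c (n + 1 - j) (-t) * x ^ j := by
  have h : ∑ j ∈ Finset.range (n + 1), (n.choose j : ℝ) * mo c (n + 1 - j) (-t) * x ^ j =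
      ∑ j ∈ Finset.range (n + 1 + 1), (n.choose j : ℝ) * mo c (n + 1 - j) (-t) * x ^ j := by
    rw [Finset.sum_range_succ _ (n + 1)]
    simp
  rw [h, Finset.sum_range_succ', Mp, Finset.sum_range_succ', Mp, Finset.mul_sum, ← add_assoc,
    ← Finset.sum_add_distrib]
  congr 1
  · refine Finset.sum_congr rfl fun i _ => ?_
    rw [Nat.choose_succ_succ, Nat.add_sub_add_right]
    push_cast
    ring
  · simp

/-- `M_1(x,t) M_n(x,t) = M_{n+1}(x,t) + t Σ_{k=1}^n C(n,k) c_{k+1} M_{n-k}(x,t)`. -/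
theorem stmt_8 (c : ℕ → ℝ) (n : ℕ) (x t : ℝ) :
    Mp c 1 x t * Mp c n x t
      = Mp c (n + 1) x t
        + t * ∑ k ∈ Finset.Icc 1 n, (n.choose k : ℝ) * c (k + 1) * Mp c (n - k) x t := by
  have h1 : Mp c 1 x t = x - c 1 * t := by
    simp [Mp, Finset.sum_range_succ, mo_succ, mo]
    ring
  have h2 : ∑ k ∈ Finset.range (n + 1), (n.choose k : ℝ) * c (k + 1) * Mp c (n - k) x t =
      c 1 * Mp c n x t +
      ∑ k ∈ Finset.Icc 1 n, (n.choose k : ℝ) * c (k + 1) * Mp c (n - k) x t := by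
    rw [Finset.range_eq_Ico, Finset.sum_eq_sum_Ico_succ_bot (by omega)]
    simp
    rfl
  rw [h1, pascal_aux, swap_aux, h2]
  ring
end

section
/- For every n ≥ 0 and all real x, t the following polynomial identity holds: M_2(x,t) · M_n(x,t) = M_{n+2}(x,t) + 2n c_2 t · M_n(x,t) + t · Σ_{k=2}^{n+1} (C(n,k−1) + 2·C(n,k)) · c_{k+1} · M_{n−k+1}(x,t) + t² · Σ_{l=2}^{n} C(n,l) · M_{n−l}(x,t) · Σ_{k=1}^{l−1} C(l,k) · c_{k+1} · c_{l−k+1}. -/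
open MeasureTheory ProbabilityTheory Filter

/-- Exponential generating function. -/
noncomputable def egf (a : ℕ → ℝ) : PowerSeries ℝ := PowerSeries.mk fun n => a n / (n.factorial : ℝ)

theorem egf_inj {a b : ℕ → ℝ} (h : egf a = egf b) (n : ℕ) : a n = b n := by
  have h1 := congrArg (PowerSeries.coeff n) h
  simp only [egf, PowerSeries.coeff_mk] at h1
  have : (n.factorial : ℝ) ≠ 0 := by positivity
  field_simp at h1
  exact h1

theorem egf_add (a b : ℕ → ℝ) : egf a + egf b = egf (fun n => a n + b n) := by
  ext n
  simp [egf, add_div]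

theorem egf_smul (r : ℝ) (a : ℕ → ℝ) : PowerSeries.C r * egf a = egf (fun n => r * a n) := by
  ext n
  simp [egf, mul_div_assoc]

theorem egf_mul (a b : ℕ → ℝ) : egf a * egf b =
    egf (fun n => ∑ j ∈ Finset.range (n + 1), (n.choose j : ℝ) * a j * b (n - j)) := by
  ext n
  rw [PowerSeries.coeff_mul, Finset.Nat.sum_antidiagonal_eq_sum_range_succ_mk]
  simp only [egf, PowerSeries.coeff_mk]
  rw [Finset.sum_div]
  refine Finset.sum_congr rfl fun j hj => ?_
  have hj' : j ≤ n := by simpa [Nat.lt_succ_iff] using hj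
  rw [Nat.cast_choose ℝ hj']
  have h1 : (n.factorial : ℝ) ≠ 0 := by positivity
  have h2 : (j.factorial : ℝ) ≠ 0 := by positivity
  have h3 : ((n - j).factorial : ℝ) ≠ 0 := by positivity
  field_simp

theorem egf_deriv (a : ℕ → ℝ) :
    PowerSeries.derivative ℝ (egf a) = egf (fun n => a (n + 1)) := by
  ext n
  rw [PowerSeries.coeff_derivative]
  simp only [egf, PowerSeries.coeff_mk, Nat.factorial_succ]
  push_cast
  have h1 : (n.factorial : ℝ) ≠ 0 := by positivity
  have h2 : (n : ℝ) + 1 ≠ 0 := by positivity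
  field_simp

theorem Mp_egf (c : ℕ → ℝ) (x t : ℝ) : egf (fun n => Mp c n x t) =
    egf (fun n => x ^ n) * egf (fun n => mo c n (-t)) := by
  rw [egf_mul]
  congr 1
  funext n
  unfold Mp
  exact Finset.sum_congr rfl fun j _ => by ring

theorem Mp_deriv (c : ℕ → ℝ) (x t : ℝ) : egf (fun n => Mp c (n + 1) x t) =
    (PowerSeries.C x - PowerSeries.C t * egf (fun n => c (n + 1))) *
      egf (fun n => Mp c n x t) := by
  have h1 : egf (fun n => x ^ (n + 1)) = PowerSeries.C x * egf (fun n => x ^ n) := by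
    rw [egf_smul]; congr 1; funext n; ring
  have h2 : egf (fun n => mo c (n + 1) (-t)) =
      PowerSeries.C (-t) * (egf (fun n => c (n + 1)) * egf (fun n => mo c n (-t))) := by
    rw [egf_mul, egf_smul]; congr 1; funext n; rw [mo]
  rw [← egf_deriv (fun n => Mp c n x t), Mp_egf, Derivation.leibniz, egf_deriv, egf_deriv, h1, h2,
    map_neg]
  simp only [smul_eq_mul]
  ring

theorem Mp_egf_two (c : ℕ → ℝ) (x t : ℝ) :
    PowerSeries.C ((x - c 1 * t) ^ 2 - t * c 2) * egf (fun n => Mp c n x t) =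
      egf (fun n => Mp c (n + 2) x t)
      + PowerSeries.C (2 * t) * (egf (fun j => if j = 0 then 0 else c (j + 1)) *
          egf (fun n => Mp c (n + 1) x t))
      + PowerSeries.C t * (egf (fun j => if j = 0 then 0 else c (j + 2)) *
          egf (fun n => Mp c n x t))
      + PowerSeries.C (t ^ 2) * ((egf (fun j => if j = 0 then 0 else c (j + 1)) *
          egf (fun j => if j = 0 then 0 else c (j + 1))) * egf (fun n => Mp c n x t)) := by
  have hk (d : ℕ → ℝ) : egf d = PowerSeries.C (d 0) + egf (fun j => if j = 0 then 0 else d j) := by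
    ext n
    rcases n with _ | n <;> simp [egf]
  have h1 := Mp_deriv c x t
  have h2 := congrArg (PowerSeries.derivative ℝ) h1
  rw [Derivation.leibniz, egf_deriv, egf_deriv, map_sub, Derivation.leibniz, egf_deriv] at h2
  simp only [PowerSeries.derivative_C, smul_eq_mul, add_assoc, Nat.reduceAdd] at h2
  rw [hk (fun n => c (n + 2))] at h2
  rw [hk (fun n => c (n + 1))] at h1 h2
  simp only [zero_add] at h1 h2
  rw [h2, h1]
  simp only [map_sub, map_mul, map_pow, map_ofNat]
  ring

theorem Mp_two (c : ℕ → ℝ) (x t : ℝ) : Mp c 2 x t = (x - c 1 * t) ^ 2 - t * c 2 := by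
  simp [Mp, Finset.sum_range_succ, mo]
  ring

/-- the product formula for `M_2(x,t) M_n(x,t)`. -/
theorem stmt_9 (c : ℕ → ℝ) (n : ℕ) (x t : ℝ) :
    Mp c 2 x t * Mp c n x t
      = Mp c (n + 2) x t + 2 * (n : ℝ) * c 2 * t * Mp c n x t
        + t * ∑ k ∈ Finset.Icc 2 (n + 1),
            ((n.choose (k - 1) : ℝ) + 2 * (n.choose k : ℝ)) * c (k + 1) * Mp c (n + 1 - k) x t
        + t ^ 2 * ∑ l ∈ Finset.Icc 2 n, (n.choose l : ℝ) * Mp c (n - l) x t *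
            ∑ k ∈ Finset.Icc 1 (l - 1), (l.choose k : ℝ) * c (k + 1) * c (l - k + 1) := by
  have h := Mp_egf_two c x t
  simp only [egf_mul, egf_smul, egf_add] at h
  have h := egf_inj h n
  rw [Mp_two, h]
  have e1 : ∑ j ∈ Finset.range (n + 1), (n.choose j : ℝ) * (if j = 0 then 0 else c (j + 1)) *
        Mp c (n - j + 1) x t = n * c 2 * Mp c n x t +
        ∑ k ∈ Finset.Icc 2 (n + 1), (n.choose k : ℝ) * c (k + 1) * Mp c (n + 1 - k) x t := by
    rw [← Finset.Ico_add_one_right_eq_Icc, Finset.sum_Ico_eq_sum_range, Finset.sum_range_succ']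
    rcases n with _ | n
    · simp
    · rw [Finset.sum_range_succ']
      have : n + 1 + 1 + 1 - 2 = n + 1 := by omega
      rw [this, Finset.sum_range_succ]
      rw [Nat.choose_eq_zero_of_lt (show n + 1 < 2 + n by omega)]
      simp
      rw [add_comm]
      congr 1
      refine Finset.sum_congr rfl fun j hj => ?_
      have hj := Finset.mem_range.1 hj
      rw [show n - (j + 1) + 1 = n + 1 + 1 - (2 + j) by omega,
        show j + 1 + 1 = 2 + j by omega]
  have e2 : ∑ j ∈ Finset.range (n + 1), (n.choose j : ℝ) * (if j = 0 then 0 else c (j + 2)) *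
        Mp c (n - j) x t =
        ∑ k ∈ Finset.Icc 2 (n + 1), (n.choose (k - 1) : ℝ) * c (k + 1) * Mp c (n + 1 - k) x t := by
    rw [← Finset.Ico_add_one_right_eq_Icc, Finset.sum_Ico_eq_sum_range, Finset.sum_range_succ']
    rw [show n + 1 + 1 - 2 = n by omega]
    simp
    refine Finset.sum_congr rfl fun j hj => ?_
    rw [show n - (j + 1) = n + 1 - (2 + j) by omega, show j + 1 + 2 = 2 + j + 1 by omega,
      show 1 + j = j + 1 by omega]
  have e3 (l : ℕ) : ∑ j ∈ Finset.range (l + 1), (l.choose j : ℝ) *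
        (if j = 0 then 0 else c (j + 1)) * (if l - j = 0 then 0 else c (l - j + 1)) =
        ∑ k ∈ Finset.Icc 1 (l - 1), (l.choose k : ℝ) * c (k + 1) * c (l - k + 1) := by
    rw [← Finset.sum_subset (s₁ := Finset.Icc 1 (l - 1)) (s₂ := Finset.range (l + 1))]
    · refine Finset.sum_congr rfl fun j hj => ?_
      have hj := Finset.mem_Icc.1 hj
      rw [if_neg (by omega), if_neg (by omega)]
    · intro j hj
      have hj := Finset.mem_Icc.1 hj
      exact Finset.mem_range.2 (by omega)
    · intro j hj hj'
      rw [Finset.mem_Icc] at hj'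
      rw [Finset.mem_range] at hj
      by_cases h0 : j = 0
      · simp [h0]
      · rw [if_pos (show l - j = 0 by omega)]; simp
  have e4 : ∑ l ∈ Finset.range (n + 1), (n.choose l : ℝ) *
        (∑ k ∈ Finset.Icc 1 (l - 1), (l.choose k : ℝ) * c (k + 1) * c (l - k + 1)) *
        Mp c (n - l) x t = ∑ l ∈ Finset.Icc 2 n, (n.choose l : ℝ) * Mp c (n - l) x t *
            ∑ k ∈ Finset.Icc 1 (l - 1), (l.choose k : ℝ) * c (k + 1) * c (l - k + 1) := by
    rw [← Finset.sum_subset (s₁ := Finset.Icc 2 n) (s₂ := Finset.range (n + 1))]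
    · exact Finset.sum_congr rfl fun j hj => by ring
    · intro j hj
      have hj := Finset.mem_Icc.1 hj
      exact Finset.mem_range.2 (by omega)
    · intro j hj hj'
      rw [Finset.mem_Icc] at hj'
      rw [Finset.mem_range] at hj
      rw [Finset.Icc_eq_empty (by omega)]; simp
  simp only [e3]
  rw [e1, e2, e4]
  have e5 : ∑ k ∈ Finset.Icc 2 (n + 1),
            ((n.choose (k - 1) : ℝ) + 2 * (n.choose k : ℝ)) * c (k + 1) * Mp c (n + 1 - k) x t =
      ∑ k ∈ Finset.Icc 2 (n + 1), (n.choose (k - 1) : ℝ) * c (k + 1) * Mp c (n + 1 - k) x t +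
      2 * ∑ k ∈ Finset.Icc 2 (n + 1), (n.choose k : ℝ) * c (k + 1) * Mp c (n + 1 - k) x t := by
    rw [Finset.mul_sum, ← Finset.sum_add_distrib]
    exact Finset.sum_congr rfl fun j hj => by ring
  rw [e5]
  ring
end

section
/- Write c_1 = E[X_1]. The process M_1(X_t,t) = X_t − c_1 t has the harness property: for all 0 < s < t < u, E[X_t − c_1 t | F_{s,u}] = ((u−t)/(u−s)) · (X_s − c_1 s) + ((t−s)/(u−s)) · (X_u − c_1 u) almost surely, where F_{s,u} = σ(X_v : v ∈ (0,s] ∪ [u,∞)). -/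
open MeasureTheory ProbabilityTheory Filter

/-- The σ-algebra `F_{s,u} = σ(X_v : v ∈ (0,s] ∪ [u,∞))`. -/
def filtMid {Ω : Type*} [MeasurableSpace Ω] (X : ℝ → Ω → ℝ) (s u : ℝ) : MeasurableSpace Ω :=
  ⨆ v ∈ Set.Ioc (0 : ℝ) s ∪ Set.Ici u, MeasurableSpace.comap (X v) inferInstance

lemma lem_signed {Ω : Type*} [MeasurableSpace Ω] (P : Measure Ω) [IsFiniteMeasure P]
    (Y W : Ω → ℝ) (hY : Measurable Y) (hW : Measurable W)
    (hint : ∀ θ : ℝ, Integrable (fun ω => W ω * Real.exp (θ * Y ω)) P)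
    (hzero : ∀ θ : ℝ, ∫ ω, W ω * Real.exp (θ * Y ω) ∂P = 0)
    (E : Set ℝ) (hE : MeasurableSet E) : ∫ ω in Y ⁻¹' E, W ω ∂P = 0 := by
  have hWi : Integrable W P := by simpa using hint 0
  have hm1 : Measurable (fun ω => ENNReal.ofReal (W ω)) := by fun_prop
  have hm2 : Measurable (fun ω => ENNReal.ofReal (-W ω)) := by fun_prop
  set μ₁ : Measure Ω := P.withDensity (fun ω => ENNReal.ofReal (W ω)) with hμ₁
  set μ₂ : Measure Ω := P.withDensity (fun ω => ENNReal.ofReal (-W ω)) with hμ₂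
  have f1 : IsFiniteMeasure μ₁ := isFiniteMeasure_withDensity_ofReal hWi.2
  have f2 : IsFiniteMeasure μ₂ := isFiniteMeasure_withDensity_ofReal hWi.neg.2
  have hi1 : ∀ θ : ℝ, Integrable (fun ω => (ENNReal.ofReal (W ω)).toReal * Real.exp (θ * Y ω)) P := by
    intro θ
    refine (hint θ).mono (by fun_prop) (ae_of_all _ fun ω => ?_)
    simp only [norm_mul, ENNReal.toReal_ofReal', Real.norm_eq_abs]
    refine mul_le_mul_of_nonneg_right ?_ (abs_nonneg _)
    rcases le_total 0 (W ω) with h | h <;> simp [h, abs_of_nonneg, abs_of_nonpos]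
  have hi2 : ∀ θ : ℝ, Integrable (fun ω => (ENNReal.ofReal (-W ω)).toReal * Real.exp (θ * Y ω)) P := by
    intro θ
    refine (hint θ).mono (by fun_prop) (ae_of_all _ fun ω => ?_)
    simp only [norm_mul, ENNReal.toReal_ofReal', Real.norm_eq_abs]
    refine mul_le_mul_of_nonneg_right ?_ (abs_nonneg _)
    rcases le_total 0 (W ω) with h | h <;> simp [h, abs_of_nonneg, abs_of_nonpos]
  have hj1 : ∀ θ : ℝ, Integrable (fun ω => Real.exp (θ * Y ω)) μ₁ := by
    intro θ
    rw [hμ₁, integrable_withDensity_iff hm1 (ae_of_all _ fun _ => ENNReal.ofReal_lt_top)]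
    simpa only [mul_comm] using hi1 θ
  have hmgf : mgf Y μ₁ = mgf Y μ₂ := by
    ext θ
    simp only [mgf]
    rw [hμ₁, hμ₂, integral_withDensity_eq_integral_toReal_smul hm1 (ae_of_all _ fun _ => ENNReal.ofReal_lt_top),
      integral_withDensity_eq_integral_toReal_smul hm2 (ae_of_all _ fun _ => ENNReal.ofReal_lt_top),
      ← sub_eq_zero]
    simp only [smul_eq_mul]
    rw [← integral_sub (hi1 θ) (hi2 θ), ← hzero θ]
    congr 1
    ext ω
    rw [← sub_mul]
    congr 1
    simp only [ENNReal.toReal_ofReal']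
    grind
  have h0 : μ₁ = 0 ↔ μ₂ = 0 := by
    have := congrFun hmgf 0
    rw [mgf_zero', mgf_zero'] at this
    rw [← Measure.measure_univ_eq_zero, ← Measure.measure_univ_eq_zero,
      ← measureReal_eq_zero_iff, ← measureReal_eq_zero_iff, this]
  have hset : integrableExpSet Y μ₁ = Set.univ := Set.eq_univ_of_forall hj1
  have hc : complexMGF Y μ₁ = complexMGF Y μ₂ := by
    ext z
    exact eqOn_complexMGF_of_mgf' hmgf h0 (by simp [hset])
  have hmap := Measure.ext_of_complexMGF_eq hY.aemeasurable hY.aemeasurable hc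
  have hEE := congrArg (fun ν => ν E) hmap
  simp only [Measure.map_apply hY hE] at hEE
  rw [hμ₁, hμ₂, withDensity_apply _ (hY hE), withDensity_apply _ (hY hE)] at hEE
  rw [integral_eq_lintegral_pos_part_sub_lintegral_neg_part hWi.integrableOn, hEE, sub_self]

lemma lem_core {Ω : Type*} [MeasurableSpace Ω] (P : Measure Ω) [IsProbabilityMeasure P]
    (A B : Ω → ℝ) (hA : Measurable A) (hB : Measurable B) (hAB : IndepFun A B P)
    (φ φ' : ℝ → ℝ) (hφ : ∀ θ, 0 < φ θ) (hφ' : ∀ θ, HasDerivAt φ (φ' θ) θ)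
    (a b : ℝ) (hab : a + b ≠ 0)
    (hiA : ∀ θ : ℝ, Integrable (fun ω => Real.exp (θ * A ω)) P)
    (hiB : ∀ θ : ℝ, Integrable (fun ω => Real.exp (θ * B ω)) P)
    (hmA : ∀ θ : ℝ, ∫ ω, Real.exp (θ * A ω) ∂P = φ θ ^ a)
    (hmB : ∀ θ : ℝ, ∫ ω, Real.exp (θ * B ω) ∂P = φ θ ^ b)
    (E : Set ℝ) (hE : MeasurableSet E) :
    ∫ ω in (fun ω => A ω + B ω) ⁻¹' E, (A ω - a / (a + b) * (A ω + B ω)) ∂P = 0 := by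
  have hsA : integrableExpSet A P = Set.univ := Set.eq_univ_of_forall hiA
  have hsB : integrableExpSet B P = Set.univ := Set.eq_univ_of_forall hiB
  have dA : ∀ θ, ∫ ω, A ω * Real.exp (θ * A ω) ∂P = φ' θ * a * φ θ ^ (a - 1) := by
    intro θ
    have h1 : HasDerivAt (mgf A P) _ θ := hasDerivAt_mgf (by simp [hsA])
    have h2 : mgf A P = fun θ => φ θ ^ a := funext hmA
    rw [h2] at h1
    exact h1.unique ((hφ' θ).rpow_const (Or.inl (hφ θ).ne'))
  have dB : ∀ θ, ∫ ω, B ω * Real.exp (θ * B ω) ∂P = φ' θ * b * φ θ ^ (b - 1) := by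
    intro θ
    have h1 : HasDerivAt (mgf B P) _ θ := hasDerivAt_mgf (by simp [hsB])
    have h2 : mgf B P = fun θ => φ θ ^ b := funext hmB
    rw [h2] at h1
    exact h1.unique ((hφ' θ).rpow_const (Or.inl (hφ θ).ne'))
  have iA : ∀ θ : ℝ, Integrable (fun ω => A ω * Real.exp (θ * A ω)) P := by
    intro θ
    simpa using integrable_pow_mul_exp_of_mem_interior_integrableExpSet (X := A) (μ := P) (v := θ) (by simp [hsA]) 1
  have iB : ∀ θ : ℝ, Integrable (fun ω => B ω * Real.exp (θ * B ω)) P := by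
    intro θ
    simpa using integrable_pow_mul_exp_of_mem_interior_integrableExpSet (X := B) (μ := P) (v := θ) (by simp [hsB]) 1
  have ind1 : ∀ θ : ℝ, IndepFun (fun ω => A ω * Real.exp (θ * A ω)) (fun ω => Real.exp (θ * B ω)) P := by
    intro θ
    exact hAB.comp (φ := fun x => x * Real.exp (θ * x)) (ψ := fun x => Real.exp (θ * x)) (by fun_prop) (by fun_prop)
  have ind2 : ∀ θ : ℝ, IndepFun (fun ω => Real.exp (θ * A ω)) (fun ω => B ω * Real.exp (θ * B ω)) P := by
    intro θ
    exact hAB.comp (φ := fun x => Real.exp (θ * x)) (ψ := fun x => x * Real.exp (θ * x)) (by fun_prop) (by fun_prop)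
  have key : ∀ θ, (fun ω => (A ω - a / (a + b) * (A ω + B ω)) * Real.exp (θ * (A ω + B ω))) =
      fun ω => b / (a + b) * ((A ω * Real.exp (θ * A ω)) * Real.exp (θ * B ω)) -
        a / (a + b) * (Real.exp (θ * A ω) * (B ω * Real.exp (θ * B ω))) := by
    intro θ
    ext ω
    rw [mul_add θ, Real.exp_add]
    field_simp
    ring
  have j1 : ∀ θ, Integrable (fun ω => b / (a + b) * ((A ω * Real.exp (θ * A ω)) * Real.exp (θ * B ω))) P :=
    fun θ => ((ind1 θ).integrable_mul (iA θ) (hiB θ)).const_mul _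
  have j2 : ∀ θ, Integrable (fun ω => a / (a + b) * (Real.exp (θ * A ω) * (B ω * Real.exp (θ * B ω)))) P :=
    fun θ => ((ind2 θ).integrable_mul (hiA θ) (iB θ)).const_mul _
  refine lem_signed P (fun ω => A ω + B ω) (fun ω => A ω - a / (a + b) * (A ω + B ω)) (by fun_prop) (by fun_prop) ?_ ?_ E hE
  · intro θ
    simp only [key]
    exact (j1 θ).sub (j2 θ)
  · intro θ
    simp only [key]
    rw [integral_sub (j1 θ) (j2 θ), integral_const_mul, integral_const_mul,
      (ind1 θ).integral_fun_mul_eq_mul_integral (by fun_prop) (by fun_prop),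
      (ind2 θ).integral_fun_mul_eq_mul_integral (by fun_prop) (by fun_prop), dA, dB, hmA, hmB,
      Real.rpow_sub_one (hφ θ).ne', Real.rpow_sub_one (hφ θ).ne']
    ring

/-- Increment measurability along a finite chain of times. -/
lemma lem_chain {Ω : Type*} [MeasurableSpace Ω] (X : ℝ → Ω → ℝ) (m : ℕ) (ts : Fin (m + 1) → ℝ)
    (S : Finset (Fin m)) (p q : Fin (m + 1)) (hpq : p ≤ q)
    (hS : ∀ i : Fin m, p ≤ i.castSucc → i.castSucc < q → i ∈ S) :
    ∃ g : (S → ℝ) → ℝ, Measurable g ∧ ∀ ω, X (ts q) ω - X (ts p) ω =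
      g (fun i => X (ts i.1.succ) ω - X (ts i.1.castSucc) ω) := by
  induction q using Fin.induction with
  | zero =>
    obtain rfl : p = 0 := le_antisymm hpq (Fin.zero_le _)
    exact ⟨fun _ => 0, by fun_prop, by simp⟩
  | succ j ih =>
    rcases hpq.eq_or_lt with h | h
    · subst h
      exact ⟨fun _ => 0, by fun_prop, by simp⟩
    · have hj : p ≤ j.castSucc := Fin.le_castSucc_iff.2 h
      obtain ⟨g, hg, hg'⟩ := ih hj (fun i h1 h2 => hS i h1 (h2.trans (Fin.castSucc_lt_succ)))
      have hjS : j ∈ S := hS j hj Fin.castSucc_lt_succ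
      refine ⟨fun x => g x + x ⟨j, hjS⟩, by fun_prop, fun ω => ?_⟩
      change _ = g _ + (X (ts j.succ) ω - X (ts j.castSucc) ω)
      rw [← hg']
      ring

lemma lem_indep {Ω : Type*} [MeasurableSpace Ω] (P : Measure Ω) [IsProbabilityMeasure P]
    (X : ℝ → Ω → ℝ) (hX : IsLevy P X) (s t u : ℝ) (hs : 0 < s) (hst : s < t) (htu : t < u) :
    IndepFun (fun ω => (X t ω - X s ω, X u ω - X t ω))
      (fun ω (v : ↥(Set.Ioc (0 : ℝ) s ∪ Set.Ici u)) =>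
        if v.1 ≤ s then X v.1 ω else X v.1 ω - X u ω) P := by
  have hmeas := hX.measurable
  suffices h : IndepFun (fun ω => (X t ω - X s ω, X u ω - X t ω))
      (fun ω (v : ↥(Set.Ioc (0 : ℝ) s ∪ Set.Ici u)) =>
        if v.1 ≤ s then X v.1 ω - X 0 ω else X v.1 ω - X u ω) P by
    refine IndepFun.process_congr_right (X := fun (v : ↥(Set.Ioc (0 : ℝ) s ∪ Set.Ici u)) ω =>
        if v.1 ≤ s then X v.1 ω - X 0 ω else X v.1 ω - X u ω)
        (X' := fun (v : ↥(Set.Ioc (0 : ℝ) s ∪ Set.Ici u)) ω =>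
        if v.1 ≤ s then X v.1 ω else X v.1 ω - X u ω) h ?_
    intro v
    filter_upwards [hX.init] with ω hω
    simp [hω]
  refine IndepFun.indepFun_process (Y := fun (v : ↥(Set.Ioc (0 : ℝ) s ∪ Set.Ici u)) ω =>
        if v.1 ≤ s then X v.1 ω - X 0 ω else X v.1 ω - X u ω) (by fun_prop) ?_ ?_
  · intro v
    split_ifs <;> fun_prop
  intro I
  classical
  let T : Finset ℝ := I.image Subtype.val ∪ {0, s, t, u}
  obtain ⟨m, hm⟩ : ∃ m, T.card = m + 1 :=
    Nat.exists_eq_succ_of_ne_zero (Finset.card_ne_zero_of_mem (a := 0) (by simp [T]))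
  let ts := T.orderEmbOfFin hm
  have hrange : ∀ x ∈ T, ∃ i, ts i = x := by
    intro x hx
    have : x ∈ Set.range (T.orderEmbOfFin hm) := by rw [Finset.range_orderEmbOfFin]; exact hx
    exact this
  have hT0 : ∀ i, 0 ≤ ts i := by
    intro i
    have : ts i ∈ T := Finset.orderEmbOfFin_mem T hm i
    simp only [T, Finset.mem_union, Finset.mem_image, Finset.mem_insert, Finset.mem_singleton] at this
    rcases this with ⟨v, -, hv⟩ | h
    · rcases v.2 with h' | h'
      · rw [← hv]; exact h'.1.le
      · rw [← hv]; exact (hs.trans (hst.trans htu)).le.trans h'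
    · rcases h with h | h | h | h <;> rw [h] <;> linarith
  have hind := hX.indep m ts hT0 ts.monotone
  obtain ⟨i0, hi0⟩ := hrange 0 (by simp [T])
  obtain ⟨is, his⟩ := hrange s (by simp [T])
  obtain ⟨it, hit⟩ := hrange t (by simp [T])
  obtain ⟨iu, hiu⟩ := hrange u (by simp [T])
  let S : Finset (Fin m) := Finset.univ.filter (fun i => is ≤ i.castSucc ∧ i.castSucc < iu)
  have hfin := hind.indepFun_finset S Sᶜ disjoint_compl_right (fun i => by fun_prop)
  have hle : ∀ i j, i ≤ j ↔ ts i ≤ ts j := fun i j => ts.le_iff_le.symm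
  obtain ⟨g1, hg1, hg1'⟩ := lem_chain X m ts S is it (by rw [hle]; linarith)
    (fun i h1 h2 => by
      have : it < iu := by rw [← not_le, hle]; linarith
      simp only [S, Finset.mem_filter_univ]
      exact ⟨h1, h2.trans this⟩)
  obtain ⟨g2, hg2, hg2'⟩ := lem_chain X m ts S it iu (by rw [hle]; linarith)
    (fun i h1 h2 => by
      have : is ≤ it := by rw [hle]; linarith
      simp only [S, Finset.mem_filter_univ]
      exact ⟨this.trans h1, h2⟩)
  have hZ : ∀ v : I, ∃ g : ((Sᶜ : Finset (Fin m)) → ℝ) → ℝ, Measurable g ∧ ∀ ω,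
      (if v.1.1 ≤ s then X v.1.1 ω - X 0 ω else X v.1.1 ω - X u ω) =
      g (fun i => X (ts i.1.succ) ω - X (ts i.1.castSucc) ω) := by
    intro v
    have hvT : v.1.1 ∈ T := by
      simp only [T, Finset.mem_union]
      exact Or.inl (Finset.mem_image_of_mem _ v.2)
    obtain ⟨iv, hiv⟩ := hrange _ hvT
    by_cases hvs : v.1.1 ≤ s
    · obtain ⟨g, hg, hg'⟩ := lem_chain X m ts Sᶜ i0 iv (by rw [hle, hi0]; exact hT0 _)
        (fun i h1 h2 => by
          have : iv ≤ is := by rw [hle]; linarith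
          simp only [S, Finset.mem_compl, Finset.mem_filter_univ, not_and, not_lt]
          intro h3
          exact absurd (h2.trans_le this) (not_lt.2 h3))
      refine ⟨g, hg, fun ω => ?_⟩
      rw [← hg', if_pos hvs, hiv, hi0]
    · have hvu : u ≤ v.1.1 := by
        rcases v.1.2 with h | h
        · exact absurd h.2 hvs
        · exact h
      obtain ⟨g, hg, hg'⟩ := lem_chain X m ts Sᶜ iu iv (by rw [hle]; linarith)
        (fun i h1 h2 => by
          simp only [S, Finset.mem_compl, Finset.mem_filter_univ, not_and, not_lt]
          intro h3
          exact h1)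
      refine ⟨g, hg, fun ω => ?_⟩
      rw [← hg', if_neg hvs, hiv, hiu]
  choose g hg hg' using hZ
  have := hfin.comp (φ := fun x => (g1 x, g2 x)) (ψ := fun x v => g v x) (by fun_prop)
    (measurable_pi_lambda _ hg)
  convert this using 1
  · ext ω : 1
    simp only [Function.comp, ← hg1', ← hg2', his, hit, hiu]
  · ext ω v
    exact hg' v ω

lemma lem_fubini {Ω ι : Type*} [MeasurableSpace Ω] (P : Measure Ω) [IsProbabilityMeasure P]
    (A B : Ω → ℝ) (Z : Ω → ι → ℝ) (hA : Measurable A) (hB : Measurable B) (hZ : Measurable Z)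
    (hi : IndepFun (fun ω => (A ω, B ω)) Z P) (r : ℝ)
    (hiA : Integrable A P) (hiB : Integrable B P)
    (hcore : ∀ E : Set ℝ, MeasurableSet E →
      ∫ ω in (fun ω => A ω + B ω) ⁻¹' E, (A ω - r * (A ω + B ω)) ∂P = 0)
    (D : Set (ℝ × (ι → ℝ))) (hD : MeasurableSet D) :
    ∫ ω in (fun ω => (A ω + B ω, Z ω)) ⁻¹' D, (A ω - r * (A ω + B ω)) ∂P = 0 := by
  have hAB : Measurable (fun ω => (A ω, B ω)) := by fun_prop
  have hmap := hi.map_prod_eq_prod_map_map hAB.aemeasurable hZ.aemeasurable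
  let D' : Set ((ℝ × ℝ) × (ι → ℝ)) := (fun p => (p.1.1 + p.1.2, p.2)) ⁻¹' D
  have hD' : MeasurableSet D' := hD.preimage (by fun_prop)
  let F : (ℝ × ℝ) × (ι → ℝ) → ℝ := D'.indicator (fun p => p.1.1 - r * (p.1.1 + p.1.2))
  have hF : Measurable F := Measurable.indicator (by fun_prop) hD'
  have hABZ : Measurable (fun ω => ((A ω, B ω), Z ω)) := by fun_prop
  have hset : MeasurableSet ((fun ω => (A ω + B ω, Z ω)) ⁻¹' D) := hD.preimage (by fun_prop)
  have hcomp : (fun ω => F ((A ω, B ω), Z ω)) =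
      ((fun ω => (A ω + B ω, Z ω)) ⁻¹' D).indicator (fun ω => A ω - r * (A ω + B ω)) := rfl
  have hWi : Integrable (fun ω => A ω - r * (A ω + B ω)) P := hiA.sub ((hiA.add hiB).const_mul r)
  have hFi : Integrable F ((P.map (fun ω => (A ω, B ω))).prod (P.map Z)) := by
    rw [← hmap, integrable_map_measure hF.aestronglyMeasurable hABZ.aemeasurable]
    change Integrable (fun ω => F ((A ω, B ω), Z ω)) P
    rw [hcomp]
    exact hWi.indicator hset
  have := Measure.isProbabilityMeasure_map (μ := P) hAB.aemeasurable
  have := Measure.isProbabilityMeasure_map (μ := P) hZ.aemeasurable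
  rw [← integral_indicator hset, ← hcomp,
    ← integral_map (φ := fun ω => ((A ω, B ω), Z ω)) hABZ.aemeasurable hF.aestronglyMeasurable,
    hmap, integral_prod_symm _ hFi]
  refine integral_eq_zero_of_ae (ae_of_all _ fun z => ?_)
  simp only [Pi.zero_apply]
  rw [integral_map hAB.aemeasurable (Measurable.aestronglyMeasurable (by fun_prop))]
  have hE : MeasurableSet {x : ℝ | (x, z) ∈ D} := hD.preimage (by fun_prop)
  rw [← hcore _ hE, ← integral_indicator (hE.preimage (by fun_prop))]
  rfl

theorem stmt_12 {Ω : Type*} [MeasurableSpace Ω] (P : Measure Ω) [IsProbabilityMeasure P]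
    (X : ℝ → Ω → ℝ) (hX : IsLevy P X)
    (hexp : ∀ (x t : ℝ), 0 ≤ t → Integrable (fun ω => Real.exp (x * X t ω)) P)
    (hpow : ∀ (x t : ℝ), 0 ≤ t →
      (∫ ω, Real.exp (x * X t ω) ∂P) = (∫ ω, Real.exp (x * X 1 ω) ∂P) ^ t)
    (c1 : ℝ) (hc1 : c1 = ∫ ω, X 1 ω ∂P)
    (s t u : ℝ) (hs : 0 < s) (hst : s < t) (htu : t < u) :
    P[(fun ω => X t ω - c1 * t) | filtMid X s u]
      =ᵐ[P] fun ω =>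
        ((u - t) / (u - s)) * (X s ω - c1 * s) + ((t - s) / (u - s)) * (X u ω - c1 * u) := by
  have hmeas := hX.measurable
  have hXi : ∀ v, 0 ≤ v → Integrable (X v) P := by
    intro v hv
    have : integrableExpSet (X v) P = Set.univ := Set.eq_univ_of_forall (fun x => hexp x v hv)
    exact integrable_of_mem_interior_integrableExpSet (by simp [this])
  have hincI : ∀ v w : ℝ, 0 ≤ v → v ≤ w → ∀ θ : ℝ,
      Integrable (fun ω => Real.exp (θ * (X w ω - X v ω))) P := by
    intro v w hv hvw θ
    have h := hX.stationary v w hv hvw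
    have h1 : Integrable (fun x : ℝ => Real.exp (θ * x)) (P.map (X (w - v))) := by
      rw [integrable_map_measure (by fun_prop) (by fun_prop)]
      exact hexp θ (w - v) (by linarith)
    rw [← h, integrable_map_measure (by fun_prop) (by fun_prop)] at h1
    exact h1
  have hincE : ∀ v w : ℝ, 0 ≤ v → v ≤ w → ∀ θ : ℝ,
      ∫ ω, Real.exp (θ * (X w ω - X v ω)) ∂P = (mgf (X 1) P θ) ^ (w - v) := by
    intro v w hv hvw θ
    have h := hX.stationary v w hv hvw
    rw [mgf, ← hpow θ (w - v) (by linarith),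
      ← integral_map (φ := X (w - v)) (f := fun x => Real.exp (θ * x)) (by fun_prop) (by fun_prop),
      ← h, integral_map (by fun_prop) (by fun_prop)]
  have hs1 : integrableExpSet (X 1) P = Set.univ :=
    Set.eq_univ_of_forall (fun x => hexp x 1 zero_le_one)
  have hind := lem_indep P X hX s t u hs hst htu
  have hABind : IndepFun (fun ω => X t ω - X s ω) (fun ω => X u ω - X t ω) P := by
    have hi := hX.indep 2 ![s, t, u]
      (by intro i; fin_cases i <;> simp <;> linarith)
      (by
        refine Fin.monotone_iff_le_succ.2 fun i => ?_
        fin_cases i <;> simp <;> linarith)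
    exact hi.indepFun (i := 0) (j := 1) (by decide)
  have hr : (t - s) / ((t - s) + (u - t)) = (t - s) / (u - s) := by congr 1; ring
  have hcore : ∀ E : Set ℝ, MeasurableSet E →
      ∫ ω in (fun ω => (X t ω - X s ω) + (X u ω - X t ω)) ⁻¹' E,
        ((X t ω - X s ω) - (t - s) / (u - s) * ((X t ω - X s ω) + (X u ω - X t ω))) ∂P = 0 := by
    intro E hE
    rw [← hr]
    exact lem_core P (fun ω => X t ω - X s ω) (fun ω => X u ω - X t ω) (by fun_prop) (by fun_prop)
      hABind (mgf (X 1) P) _ (fun θ => mgf_pos (hexp θ 1 zero_le_one))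
      (fun θ => hasDerivAt_mgf (by simp [hs1])) (t - s) (u - t) (by linarith)
      (hincI s t hs.le hst.le) (hincI t u (by linarith) htu.le)
      (hincE s t hs.le hst.le) (hincE t u (by linarith) htu.le) E hE
  let Z : Ω → ↥(Set.Ioc (0 : ℝ) s ∪ Set.Ici u) → ℝ := fun ω v =>
    if v.1 ≤ s then X v.1 ω else X v.1 ω - X u ω
  have hZ : Measurable Z := by
    refine measurable_pi_lambda _ fun v => ?_
    simp only [Z]
    split_ifs <;> fun_prop
  have hfub := lem_fubini P (fun ω => X t ω - X s ω) (fun ω => X u ω - X t ω) Z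
    (by fun_prop) (by fun_prop) hZ hind ((t - s) / (u - s))
    ((hXi t (by linarith)).sub (hXi s (by linarith)))
    ((hXi u (by linarith)).sub (hXi t (by linarith))) hcore
  have hm : filtMid X s u ≤ ‹MeasurableSpace Ω› :=
    iSup₂_le fun v _ => (hmeas v).comap_le
  have hXm : ∀ v ∈ Set.Ioc (0 : ℝ) s ∪ Set.Ici u, Measurable[filtMid X s u] (X v) := by
    intro v hv
    exact Measurable.of_comap_le
      (le_iSup₂_of_le (f := fun v (_ : v ∈ Set.Ioc (0 : ℝ) s ∪ Set.Ici u) =>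
        MeasurableSpace.comap (X v) inferInstance) v hv le_rfl)
  let YZ : Ω → ℝ × (↥(Set.Ioc (0 : ℝ) s ∪ Set.Ici u) → ℝ) :=
    fun ω => ((X t ω - X s ω) + (X u ω - X t ω), Z ω)
  have hle : filtMid X s u ≤ MeasurableSpace.comap YZ inferInstance := by
    refine iSup₂_le fun v hv => ?_
    rw [← measurable_iff_comap_le]
    have hYZ : Measurable[MeasurableSpace.comap YZ inferInstance] YZ := comap_measurable YZ
    by_cases hvs : v ≤ s
    · have : X v = (fun p => p.2 ⟨v, hv⟩) ∘ YZ := by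
        ext ω; simp [YZ, Z, hvs]
      rw [this]
      exact Measurable.comp (by fun_prop) hYZ
    · have : X v = (fun p => p.2 ⟨v, hv⟩ + (p.1 + p.2 ⟨s, Or.inl ⟨hs, le_rfl⟩⟩)) ∘ YZ := by
        ext ω; simp [YZ, Z, hvs]
      rw [this]
      exact Measurable.comp (by fun_prop) hYZ
  have hus : u - s ≠ 0 := by linarith
  have hgi : Integrable (fun ω => ((u - t) / (u - s)) * (X s ω - c1 * s) +
      ((t - s) / (u - s)) * (X u ω - c1 * u)) P :=
    (((hXi s (by linarith)).sub (integrable_const _)).const_mul _).add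
      (((hXi u (by linarith)).sub (integrable_const _)).const_mul _)
  have hfi : Integrable (fun ω => X t ω - c1 * t) P :=
    (hXi t (by linarith)).sub (integrable_const _)
  symm
  refine ae_eq_condExp_of_forall_setIntegral_eq hm hfi (fun _ _ _ => hgi.integrableOn) ?_ ?_
  · intro D hD _
    obtain ⟨D', hD', rfl⟩ := hle D hD
    symm
    rw [← sub_eq_zero, ← integral_sub hfi.integrableOn hgi.integrableOn]
    refine Eq.trans ?_ (hfub D' hD')
    congr 1
    ext ω
    field_simp
    ring
  · have m1 := hXm s (Or.inl ⟨hs, le_rfl⟩)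
    have m2 := hXm u (Or.inr Set.self_mem_Ici)
    exact (((m1.sub_const _).const_mul _).add
      ((m2.sub_const _).const_mul _)).stronglyMeasurable.aestronglyMeasurable
end

section
/- Fix k ≥ 2 and assume c_2 > 0. Suppose there exists a function μ : (0,∞) → ℝ with μ(t) ≠ 0 for all t > 0 such that (μ(t) M_k(X_t,t), F_{≥t}) is a reversed martingale, i.e. for all 0 < s < t: E[μ(s) M_k(X_s,s) | F_{≥t}] = μ(t) M_k(X_t,t) almost surely, where F_{≥t} = σ(X_u : u ≥ t). Then c_j = 0 for every j with max(3, k−1) ≤ j ≤ 2k−1. -/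
open MeasureTheory ProbabilityTheory Filter

namespace Stmt13
open Polynomial

theorem mo_zero (c : ℕ → ℝ) (t : ℝ) : mo c 0 t = 1 := by rw [mo]

theorem mo_succ (c : ℕ → ℝ) (n : ℕ) (t : ℝ) : mo c (n+1) t =
    t * ∑ j ∈ Finset.range (n + 1), (n.choose j : ℝ) * c (j + 1) * mo c (n - j) t := by
  rw [mo]

noncomputable def Eg (c : ℕ → ℝ) (t : ℝ) : PowerSeries ℝ :=
  PowerSeries.mk fun n => mo c n t / (n.factorial : ℝ)

noncomputable def Kg (c : ℕ → ℝ) : PowerSeries ℝ :=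
  PowerSeries.mk fun n => c (n+1) / (n.factorial : ℝ)

theorem choose_div (n j : ℕ) (h : j ≤ n) : ((n.choose j : ℕ) : ℝ) / (n.factorial : ℝ)
    = 1 / ((j.factorial : ℝ) * ((n-j).factorial : ℝ)) := by
  rw [Nat.cast_choose ℝ h]
  have := n.factorial_ne_zero
  field_simp

theorem Eg_deriv (c : ℕ → ℝ) (t : ℝ) :
    PowerSeries.derivative ℝ (Eg c t) = PowerSeries.C t * (Kg c * Eg c t) := by
  ext n
  rw [PowerSeries.coeff_derivative, PowerSeries.coeff_C_mul, PowerSeries.coeff_mul,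
    Finset.Nat.sum_antidiagonal_eq_sum_range_succ_mk]
  simp only [Eg, Kg, PowerSeries.coeff_mk]
  rw [mo_succ, Nat.factorial_succ]
  push_cast
  have h1 : ((n:ℝ)+1) ≠ 0 := by positivity
  have h2 : (n.factorial : ℝ) ≠ 0 := by positivity
  rw [show ∀ a b : ℝ, t * a / ((n+1) * b) * (n+1) = t * (a / b) by intro a b; field_simp]
  rw [Finset.sum_div]
  congr 1
  refine Finset.sum_congr rfl fun j hj => ?_
  have := choose_div n j (by simpa [Nat.lt_succ_iff] using hj)
  rw [show ((n.choose j : ℕ) : ℝ) * c (j+1) * mo c (n-j) t / (n.factorial : ℝ) =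
    (((n.choose j : ℕ) : ℝ) / (n.factorial : ℝ)) * c (j+1) * mo c (n-j) t by ring, this]
  field_simp

theorem ode_unique (K F G : PowerSeries ℝ)
    (hF : PowerSeries.derivative ℝ F = K * F) (hG : PowerSeries.derivative ℝ G = K * G)
    (h0 : PowerSeries.coeff 0 F = PowerSeries.coeff 0 G) : F = G := by
  ext n
  induction n using Nat.strong_induction_on with
  | _ n ih =>
    rcases n with _ | n
    · exact h0
    · have e1 := congrArg (PowerSeries.coeff n) hF
      have e2 := congrArg (PowerSeries.coeff n) hG
      rw [PowerSeries.coeff_derivative, PowerSeries.coeff_mul] at e1 e2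
      have : ((n:ℝ)+1) ≠ 0 := by positivity
      apply mul_right_cancel₀ this
      rw [e1, e2]
      refine Finset.sum_congr rfl fun p hp => ?_
      rw [ih p.2]
      have := Finset.HasAntidiagonal.mem_antidiagonal.1 hp
      omega

theorem Eg_add (c : ℕ → ℝ) (s t : ℝ) : Eg c (s+t) = Eg c s * Eg c t := by
  apply ode_unique (PowerSeries.C (s+t) * Kg c)
  · rw [Eg_deriv]; ring
  · rw [Derivation.leibniz, Eg_deriv, Eg_deriv, map_add]
    simp only [smul_eq_mul]
    ring
  · simp [Eg, mo_zero, PowerSeries.coeff_mul]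

theorem mo_add (c : ℕ → ℝ) (n : ℕ) (s t : ℝ) : mo c n (s+t) =
    ∑ a ∈ Finset.range (n+1), (n.choose a : ℝ) * mo c a s * mo c (n-a) t := by
  have h := congrArg (PowerSeries.coeff n) (Eg_add c s t)
  rw [PowerSeries.coeff_mul, Finset.Nat.sum_antidiagonal_eq_sum_range_succ_mk] at h
  simp only [Eg, PowerSeries.coeff_mk] at h
  have h2 : (n.factorial : ℝ) ≠ 0 := by positivity
  rw [div_eq_iff h2, Finset.sum_mul] at h
  rw [h]
  refine Finset.sum_congr rfl fun j hj => ?_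
  have := Nat.cast_choose ℝ (show j ≤ n by simpa [Nat.lt_succ_iff] using hj)
  rw [this]
  field_simp

noncomputable def Pp (c : ℕ → ℝ) (n : ℕ) (t : ℝ) : ℝ[X] :=
  ∑ j ∈ Finset.range (n + 1), C ((n.choose j : ℝ) * mo c (n - j) (-t)) * X ^ j

theorem Pp_eval (c : ℕ → ℝ) (n : ℕ) (t x : ℝ) : (Pp c n t).eval x = Mp c n x t := by
  simp [Pp, Mp, eval_finsetSum]

theorem Pp_coeff (c : ℕ → ℝ) (n : ℕ) (t : ℝ) (i : ℕ) :
    (Pp c n t).coeff i = (n.choose i : ℝ) * mo c (n - i) (-t) := by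
  simp only [Pp, finsetSum_coeff, coeff_C_mul, coeff_X_pow]
  by_cases h : i < n + 1
  · rw [Finset.sum_eq_single i]
    · simp
    · intro b _ hb; simp [hb.symm]
    · intro h'; exact absurd (Finset.mem_range.2 h) h'
  · rw [Finset.sum_eq_zero]
    · rw [Nat.choose_eq_zero_of_lt (by omega)]; simp
    · intro b hb
      have := Finset.mem_range.1 hb
      rw [if_neg (by omega)]; simp

theorem Pp_natDegree (c : ℕ → ℝ) (n : ℕ) (t : ℝ) : (Pp c n t).natDegree ≤ n := by
  rw [natDegree_le_iff_coeff_eq_zero]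
  intro N hN
  rw [Pp_coeff, Nat.choose_eq_zero_of_lt hN]; simp

theorem choose_nat (n a i : ℕ) : (n.choose a) * ((n-a).choose i) = (n.choose i) * ((n-i).choose a) := by
  by_cases h : a + i ≤ n
  · have h1 := Nat.choose_mul (n := n) (k := a + i) (s := a) (by omega)
    have h2 := Nat.choose_mul (n := n) (k := a + i) (s := i) (by omega)
    rw [show a + i - a = i by omega] at h1
    rw [show a + i - i = a by omega] at h2
    rw [← h1, ← h2, Nat.choose_symm_add]
  · have e1 : n.choose a * (n-a).choose i = 0 := by
      by_cases ha : n < a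
      · rw [Nat.choose_eq_zero_of_lt ha, zero_mul]
      · rw [Nat.choose_eq_zero_of_lt (show n - a < i by omega), mul_zero]
    have e2 : n.choose i * (n-i).choose a = 0 := by
      by_cases ha : n < i
      · rw [Nat.choose_eq_zero_of_lt ha, zero_mul]
      · rw [Nat.choose_eq_zero_of_lt (show n - i < a by omega), mul_zero]
    rw [e1, e2]

theorem choose_real (n a i : ℕ) : (n.choose a : ℝ) * ((n-a).choose i : ℝ)
    = (n.choose i : ℝ) * ((n-i).choose a : ℝ) := by exact_mod_cast choose_nat n a i

theorem Pp_hasse (c : ℕ → ℝ) (n : ℕ) (t : ℝ) (a : ℕ) :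
    hasseDeriv a (Pp c n t) = C (n.choose a : ℝ) * Pp c (n-a) t := by
  ext i
  rw [hasseDeriv_coeff, coeff_C_mul, Pp_coeff, Pp_coeff]
  have h : ((i+a).choose a : ℝ) * (n.choose (i+a) : ℝ) = (n.choose a : ℝ) * ((n-a).choose i : ℝ) := by
    by_cases h : i + a ≤ n
    · have h1 := Nat.choose_mul (n := n) (k := i + a) (s := a) (by omega)
      rw [show i + a - a = i by omega] at h1
      rw [mul_comm]
      exact_mod_cast h1
    · rw [Nat.choose_eq_zero_of_lt (show n < i + a by omega)]
      by_cases ha : n < a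
      · rw [Nat.choose_eq_zero_of_lt ha]; simp
      · rw [Nat.choose_eq_zero_of_lt (show n - a < i by omega)]; simp
  rw [← mul_assoc, h, mul_assoc, show n - (i+a) = n - a - i by omega]

theorem sum_extend (n i : ℕ) (f : ℕ → ℝ) :
    ∑ a ∈ Finset.range (n+1), ((n-i).choose a : ℝ) * f a
     = ∑ a ∈ Finset.range (n-i+1), ((n-i).choose a : ℝ) * f a := by
  symm
  apply Finset.sum_subset
  · intro x hx; simp only [Finset.mem_range] at *; omega
  · intro x _ hx
    simp only [Finset.mem_range] at hx
    rw [Nat.choose_eq_zero_of_lt (by omega)]; simp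

theorem Pp_shift (c : ℕ → ℝ) (n : ℕ) (t u : ℝ) :
    ∑ a ∈ Finset.range (n+1), C ((n.choose a : ℝ) * mo c a u) * Pp c (n-a) t = Pp c n (t-u) := by
  ext i
  rw [finsetSum_coeff, Pp_coeff, show -(t-u) = u + -t by ring, mo_add, Finset.mul_sum]
  have := sum_extend n i (fun a => (n.choose i : ℝ) * (mo c a u * mo c (n-i-a) (-t)))
  rw [show ∀ f g : ℕ → ℝ, (∑ a ∈ Finset.range (n+1), f a = ∑ a ∈ Finset.range (n-i+1), g a) =
    (∑ a ∈ Finset.range (n+1), f a = ∑ a ∈ Finset.range (n-i+1), g a) from fun _ _ => rfl]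
  refine Eq.trans ?_ (this.trans ?_)
  · refine Finset.sum_congr rfl fun a _ => ?_
    rw [coeff_C_mul, Pp_coeff, show n - a - i = n - i - a by omega]
    linear_combination (mo c a u * mo c (n-i-a) (-t)) * choose_real n a i
  · refine Finset.sum_congr rfl fun a _ => ?_
    ring

theorem Pp_succ (c : ℕ → ℝ) (n : ℕ) (t : ℝ) :
    Pp c (n+1) t = X * Pp c n t
      - ∑ j ∈ Finset.range (n+1), C (t * ((n.choose j : ℝ) * c (j+1))) * Pp c (n-j) t := by
  have key : ∀ i, (n.choose i : ℝ) * mo c (n-i+1) (-t) =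
      - ∑ j ∈ Finset.range (n+1), t * ((n.choose j : ℝ) * c (j+1)) * (Pp c (n-j) t).coeff i := by
    intro i
    rw [mo_succ]
    have := sum_extend n i (fun a => (n.choose i : ℝ) * (-t) * (c (a+1) * mo c (n-i-a) (-t)))
    rw [Finset.mul_sum, Finset.mul_sum, ← Finset.sum_neg_distrib]
    refine Eq.trans ?_ (this.symm.trans ?_)
    · refine Finset.sum_congr rfl fun a _ => ?_
      ring
    · refine Finset.sum_congr rfl fun a _ => ?_
      rw [Pp_coeff, show n - a - i = n - i - a by omega]
      linear_combination (t * c (a+1) * mo c (n-i-a) (-t)) * choose_real n a i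
  ext i
  rw [coeff_sub, finsetSum_coeff]
  simp only [coeff_C_mul]
  rw [sub_eq_add_neg, ← key, Pp_coeff]
  rcases i with _ | i
  · simp
  · rw [coeff_X_mul, Pp_coeff, Nat.choose_succ_succ, show n + 1 - (i+1) = n - i by omega]
    by_cases h : i + 1 ≤ n
    · rw [show n - (i+1) + 1 = n - i by omega]; push_cast; ring
    · rw [Nat.choose_eq_zero_of_lt (show n < i + 1 by omega)]; simp

/-- moment functional -/
noncomputable def Lf (c : ℕ → ℝ) (t : ℝ) : ℝ[X] →ₗ[ℝ] ℝ :=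
  Polynomial.lsum (fun n => mo c n t • LinearMap.id)

theorem Lf_monomial (c : ℕ → ℝ) (t : ℝ) (n : ℕ) (a : ℝ) : Lf c t (monomial n a) = mo c n t * a := by
  simp [Lf, Polynomial.lsum_apply, Polynomial.sum_monomial_index]

theorem Lf_C_mul (c : ℕ → ℝ) (t : ℝ) (a : ℝ) (p : ℝ[X]) : Lf c t (C a * p) = a * Lf c t p := by
  rw [← smul_eq_C_mul, map_smul, smul_eq_mul]

theorem Lf_X_mul (c : ℕ → ℝ) (t : ℝ) (p : ℝ[X]) (N : ℕ) (hN : p.natDegree ≤ N) :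
    Lf c t (X * p) = t * ∑ j ∈ Finset.range (N+1), c (j+1) * Lf c t (hasseDeriv j p) := by
  have mono : ∀ n a, n ≤ N → Lf c t (X * monomial n a) =
      t * ∑ j ∈ Finset.range (N+1), c (j+1) * Lf c t (hasseDeriv j (monomial n a)) := by
    intro n a hn
    rw [X_mul_monomial, Lf_monomial, mo_succ]
    simp only [hasseDeriv_monomial, Lf_monomial]
    rw [mul_assoc, Finset.sum_mul]
    congr 1
    refine Eq.trans ?_ (Finset.sum_subset (s₁ := Finset.range (n+1)) ?_ ?_)
    · refine Finset.sum_congr rfl fun a _ => ?_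
      ring
    · intro x hx; simp only [Finset.mem_range] at *; omega
    · intro x _ hx
      simp only [Finset.mem_range] at hx
      rw [Nat.choose_eq_zero_of_lt (by omega)]; simp
  rw [as_sum_range' p (N+1) (by omega)]
  rw [Finset.mul_sum, map_sum]
  simp only [map_sum, Finset.mul_sum]
  rw [Finset.sum_comm]
  refine Finset.sum_congr rfl fun n hn => ?_
  rw [mono n _ (by have := Finset.mem_range.1 hn; omega), Finset.mul_sum]


theorem sum_box (k n : ℕ) (f : ℕ → ℕ → ℝ) (hf : ∀ a b, ¬ (a ≤ k ∧ b ≤ n) → f a b = 0) :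
    ∑ j ∈ Finset.range (k+n+1), ∑ p ∈ Finset.HasAntidiagonal.antidiagonal j, f p.1 p.2
     = ∑ a ∈ Finset.range (k+1), ∑ b ∈ Finset.range (n+1), f a b := by
  rw [← Finset.sum_product']
  rw [← Finset.sum_fiberwise_of_maps_to (t := Finset.range (k+n+1)) (g := fun p : ℕ × ℕ => p.1 + p.2)]
  · refine Finset.sum_congr rfl fun j _ => ?_
    symm
    apply Finset.sum_subset
    · intro p hp
      simp only [Finset.mem_filter] at hp
      exact Finset.HasAntidiagonal.mem_antidiagonal.2 hp.2
    · intro p hp hp'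
      apply hf
      intro h
      apply hp'
      have := Finset.HasAntidiagonal.mem_antidiagonal.1 hp
      simp only [Finset.mem_filter, Finset.mem_product, Finset.mem_range]
      omega
  · intro p hp
    simp only [Finset.mem_product, Finset.mem_range] at *
    omega

theorem L_rec (c : ℕ → ℝ) (t : ℝ) (k n : ℕ) :
    Lf c t (Pp c k t * Pp c (n+1) t) = t * ∑ i ∈ Finset.range k, ∑ j ∈ Finset.range (n+1),
      (k.choose (i+1) : ℝ) * (n.choose j : ℝ) * c (i+j+2) * 
        Lf c t (Pp c (k-(i+1)) t * Pp c (n-j) t) := by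
  have h1 : Lf c t (X * (Pp c k t * Pp c n t)) = t * ∑ a ∈ Finset.range (k+1),
      ∑ b ∈ Finset.range (n+1), (k.choose a : ℝ) * (n.choose b : ℝ) * c (a+b+1) * 
        Lf c t (Pp c (k-a) t * Pp c (n-b) t) := by
    rw [Lf_X_mul c t _ (k+n) (natDegree_mul_le.trans
      (add_le_add (Pp_natDegree c k t) (Pp_natDegree c n t)))]
    rw [← sum_box k n (fun a b => (k.choose a : ℝ) * (n.choose b : ℝ) * c (a+b+1) * 
        Lf c t (Pp c (k-a) t * Pp c (n-b) t))]
    · congr 1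
      refine Finset.sum_congr rfl fun j _ => ?_
      rw [hasseDeriv_mul, map_sum, Finset.mul_sum]
      refine Finset.sum_congr rfl fun p hp => ?_
      have := Finset.HasAntidiagonal.mem_antidiagonal.1 hp
      rw [Pp_hasse, Pp_hasse, this, 
        show ∀ (a b : ℝ) (p q : ℝ[X]), C a * p * (C b * q) = C (a * b) * (p * q) by
          intro a b p q; rw [C_mul]; ring, Lf_C_mul]
      ring
    · intro a b hab
      by_cases ha : a ≤ k
      · rw [Nat.choose_eq_zero_of_lt (show n < b by omega)]; simp
      · rw [Nat.choose_eq_zero_of_lt (show k < a by omega)]; simp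
  rw [Pp_succ, mul_sub, map_sub, show Pp c k t * (X * Pp c n t) = X * (Pp c k t * Pp c n t) by ring, h1,
    Finset.sum_range_succ']
  rw [mul_add, Finset.mul_sum (Finset.range (n+1)) _ (Pp c k t), map_sum]
  have : ∀ A B D E : ℝ, A = E → B = D → A + B - D = E := by intro A B D E h h'; rw [h, h']; ring
  apply this
  · congr 1
    refine Finset.sum_congr rfl fun i _ => ?_
    refine Finset.sum_congr rfl fun j _ => ?_
    rw [show i + 1 + j + 1 = i + j + 2 by ring]
  · rw [Finset.mul_sum]
    refine Finset.sum_congr rfl fun j _ => ?_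
    rw [mul_left_comm (Pp c k t), Lf_C_mul]
    simp
    ring

noncomputable def Qp (c : ℕ → ℝ) : ℕ → ℕ → ℝ[X]
  | 0 => fun k => if k = 0 then 1 else 0
  | n + 1 => fun k => X * ∑ i ∈ Finset.range k, ∑ j ∈ Finset.range (n+1),
      C ((k.choose (i+1) : ℝ) * (n.choose j : ℝ) * c (i+j+2)) * Qp c (n-j) (k-(i+1))
  decreasing_by omega

theorem Qp_zero (c : ℕ → ℝ) (k : ℕ) : Qp c 0 k = if k = 0 then 1 else 0 := by rw [Qp]

theorem Qp_succ (c : ℕ → ℝ) (n k : ℕ) : Qp c (n+1) k = X * ∑ i ∈ Finset.range k, ∑ j ∈ Finset.range (n+1),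
      C ((k.choose (i+1) : ℝ) * (n.choose j : ℝ) * c (i+j+2)) * Qp c (n-j) (k-(i+1)) := by
  rw [Qp]

theorem Pp_zero (c : ℕ → ℝ) (t : ℝ) : Pp c 0 t = 1 := by
  simp [Pp, mo_zero]

theorem Lf_one (c : ℕ → ℝ) (t : ℝ) : Lf c t 1 = 1 := by
  have := Lf_monomial c t 0 1
  rw [mo_zero] at this
  simpa using this

theorem Qp_eval (c : ℕ → ℝ) (t : ℝ) (n k : ℕ) :
    (Qp c n k).eval t = Lf c t (Pp c k t * Pp c n t) := by
  induction n using Nat.strong_induction_on generalizing k with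
  | _ n ih =>
    rcases n with _ | n
    · rw [Qp_zero, Pp_zero, mul_one]
      rcases k with _ | k
      · simp [Pp_zero, Lf_one]
      · have := L_rec c t 0 k
        rw [Pp_zero, one_mul] at this
        rw [this]; simp
    · rw [Qp_succ, L_rec]
      simp only [eval_mul, eval_X, eval_finsetSum, eval_C]
      congr 1
      refine Finset.sum_congr rfl fun i _ => Finset.sum_congr rfl fun j _ => ?_
      rw [ih (n-j) (by omega)]

theorem Qp_natDegree (c : ℕ → ℝ) (n k : ℕ) : (Qp c n k).natDegree ≤ n := by
  induction n using Nat.strong_induction_on generalizing k with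
  | _ n ih =>
    rcases n with _ | n
    · rw [Qp_zero]; split_ifs <;> simp
    · rw [Qp_succ]
      refine natDegree_mul_le.trans ?_
      have : (∑ i ∈ Finset.range k, ∑ j ∈ Finset.range (n+1),
        C ((k.choose (i+1) : ℝ) * (n.choose j : ℝ) * c (i+j+2)) * Qp c (n-j) (k-(i+1))).natDegree ≤ n := by
        refine natDegree_sum_le_of_forall_le _ _ fun i _ => natDegree_sum_le_of_forall_le _ _ fun j _ => ?_
        refine (natDegree_C_mul_le _ _).trans ((ih (n-j) (by omega) _).trans (by omega))
      rw [natDegree_X]; omega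

theorem Qp_coeff_zero (c : ℕ → ℝ) (n k : ℕ) (h : 0 < n ∨ 0 < k) : (Qp c n k).coeff 0 = 0 := by
  rcases n with _ | n
  · rw [Qp_zero, if_neg (by omega)]; simp
  · rw [Qp_succ]; simp

theorem Qp_coeff_one (c : ℕ → ℝ) (n k : ℕ) : (Qp c (n+1) (k+1)).coeff 1 = c (k+n+2) := by
  rw [Qp_succ, show (1:ℕ) = 0 + 1 from rfl, coeff_X_mul, finsetSum_coeff]
  simp only [finsetSum_coeff, coeff_C_mul]
  rw [Finset.sum_eq_single k, Finset.sum_eq_single n]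
  · simp [Qp_zero]
  · intro j hj hne
    have := Finset.mem_range.1 hj
    rw [Qp_coeff_zero _ _ _ (by omega)]; simp
  · simp
  · intro j hj hne
    have := Finset.mem_range.1 hj
    apply Finset.sum_eq_zero
    intro i _
    rw [Qp_coeff_zero _ _ _ (by omega)]; simp
  · simp

theorem Qp_top (c : ℕ → ℝ) (n k : ℕ) : (Qp c (n+1) k).coeff (n+1) = 
    ∑ i ∈ Finset.range k, (k.choose (i+1) : ℝ) * c (i+2) * (Qp c n (k-(i+1))).coeff n := by
  rw [Qp_succ, coeff_X_mul, finsetSum_coeff]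
  simp only [finsetSum_coeff, coeff_C_mul]
  refine Finset.sum_congr rfl fun i _ => ?_
  rw [Finset.sum_eq_single 0]
  · simp
  · intro j hj hne
    rw [coeff_eq_zero_of_natDegree_lt, mul_zero]
    have := Qp_natDegree c (n-j) (k-(i+1))
    have := Finset.mem_range.1 hj
    omega
  · simp

theorem Qp_top_lt (c : ℕ → ℝ) (n k : ℕ) (h : k < n) : (Qp c n k).coeff n = 0 := by
  induction n generalizing k with
  | zero => omega
  | succ n ih =>
    rw [Qp_top]
    apply Finset.sum_eq_zero
    intro i hi
    have := Finset.mem_range.1 hi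
    rw [ih _ (by omega), mul_zero]

theorem Qp_top_eq (c : ℕ → ℝ) (hc : 0 < c 2) (n : ℕ) : 0 < (Qp c n n).coeff n := by
  induction n with
  | zero => simp [Qp_zero]
  | succ n ih =>
    rw [Qp_top, Finset.sum_eq_single 0]
    · simp only [zero_add, Nat.add_sub_cancel, Nat.choose_one_right]
      positivity
    · intro i hi hne
      have := Finset.mem_range.1 hi
      rw [Qp_top_lt _ _ _ (by omega), mul_zero]
    · simp

theorem Qp_top_d (c : ℕ → ℝ) (hc : 0 < c 2) (d : ℕ) (hd : 1 ≤ d) 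
    (h0 : ∀ j, 3 ≤ j → j < d + 2 → c j = 0) (n : ℕ) (hn : 1 ≤ n) :
    ∃ a : ℝ, 0 < a ∧ (Qp c n (n+d)).coeff n = a * c (d+2) := by
  have step : ∀ n : ℕ, (Qp c (n+1) (n+1+d)).coeff (n+1) = 
      ((n:ℝ)+1+d) * c 2 * (Qp c n (n+d)).coeff n
       + ((n+1+d).choose (d+1) : ℝ) * c (d+2) * (Qp c n n).coeff n := by
    intro n
    rw [Qp_top]
    have hsub : ({0, d} : Finset ℕ) ⊆ Finset.range (n+1+d) := by
      intro x hx
      simp only [Finset.mem_insert, Finset.mem_singleton] at hx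
      simp only [Finset.mem_range]; omega
    rw [← Finset.sum_subset hsub, Finset.sum_pair (by omega)]
    · rw [show n + 1 + d - (0+1) = n + d by omega, show n + 1 + d - (d+1) = n by omega]
      simp
    · intro i hi hne
      simp only [Finset.mem_insert, Finset.mem_singleton, not_or] at hne
      by_cases hid : i < d
      · rw [h0 (i+2) (by omega) (by omega)]; simp
      · rw [Qp_top_lt _ _ _ (by have := Finset.mem_range.1 hi; omega), mul_zero]
  induction n with
  | zero => omega
  | succ n ih =>
    have pos2 : 0 < ((n+1+d).choose (d+1) : ℝ) := by
      exact_mod_cast Nat.choose_pos (by omega)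
    have pos3 := Qp_top_eq c hc n
    rw [step]
    rcases Nat.eq_zero_or_pos n with h | h
    · subst h
      refine ⟨_, mul_pos pos2 pos3, ?_⟩
      rw [Qp_zero c (0+d), if_neg (by omega)]
      simp only [coeff_zero]
      ring
    · obtain ⟨a, ha, e⟩ := ih h
      refine ⟨((n:ℝ)+1+d) * c 2 * a + ((n+1+d).choose (d+1) : ℝ) * (Qp c n n).coeff n, by positivity, ?_⟩
      rw [e]; ring

theorem algebra_main (c : ℕ → ℝ) (hc : 0 < c 2) (k : ℕ) 
    (h : ∀ n, 1 ≤ n → n < k → Qp c n k = 0) (j : ℕ) (h3 : 3 ≤ j) (hj : j ≤ 2*k-1) : c j = 0 := by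
  have low : ∀ j, 3 ≤ j → j ≤ k + 1 → c j = 0 := by
    intro j
    induction j using Nat.strong_induction_on with
    | _ j ih =>
      intro h3 hj
      obtain ⟨a, ha, e⟩ := Qp_top_d c hc (j-2) (by omega) 
        (fun i hi1 hi2 => ih i (by omega) hi1 (by omega)) (k-(j-2)) (by omega)
      rw [show k - (j-2) + (j-2) = k by omega, h _ (by omega) (by omega), coeff_zero,
        show j - 2 + 2 = j by omega] at e
      rcases mul_eq_zero.1 e.symm with h | h
      · exact absurd h ha.ne'
      · exact h
  by_cases hjk : j ≤ k + 1
  · exact low j h3 hjk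
  · have := Qp_coeff_one c (j-k-1) (k-1)
    rw [show k - 1 + 1 = k by omega, h _ (by omega) (by omega), coeff_zero,
      show k - 1 + (j-k-1) + 2 = j by omega] at this
    exact this.symm

theorem poly_step (c : ℕ → ℝ) (hc : 0 < c 2) (k : ℕ) (μ : ℝ → ℝ) (hμ : ∀ t : ℝ, 0 < t → μ t ≠ 0)
    (h : ∀ n s t, 0 < s → s < t → μ s * (Qp c n k).eval s = μ t * (Qp c n k).eval t)
    (n : ℕ) (hn : n < k) : Qp c n k = 0 := by
  have hconst : ∀ n t, 0 < t → μ t * (Qp c n k).eval t = μ 1 * (Qp c n k).eval 1 := by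
    intro n t ht
    rcases lt_trichotomy t 1 with h1 | h1 | h1
    · exact h n t 1 ht h1
    · rw [h1]
    · exact (h n 1 t one_pos h1).symm
  have ext0 : ∀ p : ℝ[X], (∀ t, 0 < t → p.eval t = 0) → p = 0 := by
    intro p hp
    apply Polynomial.eq_zero_of_infinite_isRoot
    exact (Set.Ioi_infinite (0:ℝ)).mono fun t ht => hp t ht
  set d := fun n => μ 1 * (Qp c n k).eval 1 with hd
  have hkk := Qp_top_eq c hc k
  have hdk : d k ≠ 0 := by
    intro h0
    have : Qp c k k = 0 := ext0 _ fun t ht => by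
      have := hconst k t ht
      change _ = d k at this
      rw [h0] at this
      exact (mul_eq_zero.1 this).resolve_left (hμ t ht)
    rw [this] at hkk
    simp at hkk
  have e : C (d n) * Qp c k k - C (d k) * Qp c n k = 0 := ext0 _ fun t ht => by
    simp only [eval_sub, eval_mul, eval_C]
    apply mul_left_cancel₀ (hμ t ht)
    have h1 := hconst k t ht
    have h2 := hconst n t ht
    change _ = d k at h1
    change _ = d n at h2
    linear_combination d n * h1 - d k * h2
  have e2 := congrArg (fun p => p.coeff k) e
  simp only [coeff_sub, coeff_C_mul, coeff_zero] at e2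
  rw [coeff_eq_zero_of_natDegree_lt ((Qp_natDegree c n k).trans_lt hn)] at e2
  have hdn : d n = 0 := by
    rcases mul_eq_zero.1 (show d n * (Qp c k k).coeff k = 0 by linarith) with h | h
    · exact h
    · exact absurd h hkk.ne'
  rw [hdn] at e
  simp only [map_zero, zero_mul, zero_sub, neg_eq_zero] at e
  rcases mul_eq_zero.1 e with h | h
  · exact absurd (C_eq_zero.1 h) hdk
  · exact h


section prob
variable {Ω : Type*} [MeasurableSpace Ω] {P : Measure Ω} [IsProbabilityMeasure P]
    {X : ℝ → Ω → ℝ} {c : ℕ → ℝ}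

theorem pow_int (hX : IsLevy P X) (hmom : ∀ (n : ℕ) (t : ℝ), 0 ≤ t → Integrable (fun ω => |X t ω| ^ n) P)
    (n : ℕ) (t : ℝ) (ht : 0 ≤ t) : Integrable (fun ω => X t ω ^ n) P := by
  refine (hmom n t ht).mono' ((hX.measurable t).pow_const n).aestronglyMeasurable ?_
  filter_upwards with ω
  simp

theorem poly_int (hX : IsLevy P X) (hmom : ∀ (n : ℕ) (t : ℝ), 0 ≤ t → Integrable (fun ω => |X t ω| ^ n) P)
    (p : ℝ[X]) (t : ℝ) (ht : 0 ≤ t) : Integrable (fun ω => p.eval (X t ω)) P := by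
  simp only [eval_eq_sum_range]
  exact integrable_finsetSum _ fun i _ => (pow_int hX hmom i t ht).const_mul _

theorem poly_integral (hX : IsLevy P X) (hmom : ∀ (n : ℕ) (t : ℝ), 0 ≤ t → Integrable (fun ω => |X t ω| ^ n) P)
    (hm : ∀ (n : ℕ) (t : ℝ), 0 ≤ t → (∫ ω, (X t ω) ^ n ∂P) = mo c n t)
    (p : ℝ[X]) (t : ℝ) (ht : 0 ≤ t) : ∫ ω, p.eval (X t ω) ∂P = Lf c t p := by
  simp only [eval_eq_sum_range]
  rw [integral_finsetSum _ fun i _ => (pow_int hX hmom i t ht).const_mul _]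
  conv_rhs => rw [p.as_sum_range, map_sum]
  refine Finset.sum_congr rfl fun i _ => ?_
  rw [integral_const_mul, hm i t ht, Lf_monomial, mul_comm]

theorem indep_incr (hX : IsLevy P X) (s t : ℝ) (hs : 0 ≤ s) (hst : s ≤ t) :
    IndepFun (X s) (fun ω => X t ω - X s ω) P := by
  have h := hX.indep 2 ![0, s, t] (by intro i; fin_cases i <;> simp <;> linarith) (by
    intro i j hij
    fin_cases i <;> fin_cases j <;> simp at hij ⊢ <;> linarith)
  have h2 := h.indepFun (show (0 : Fin 2) ≠ 1 by decide)
  refine h2.congr ?_ ?_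
  · filter_upwards [hX.init] with ω hω
    simp [hω]
  · filter_upwards with ω
    simp

theorem incr_pow (hX : IsLevy P X) (hmom : ∀ (n : ℕ) (t : ℝ), 0 ≤ t → Integrable (fun ω => |X t ω| ^ n) P)
    (hm : ∀ (n : ℕ) (t : ℝ), 0 ≤ t → (∫ ω, (X t ω) ^ n ∂P) = mo c n t)
    (n : ℕ) (s t : ℝ) (hs : 0 ≤ s) (hst : s ≤ t) :
    Integrable (fun ω => (X t ω - X s ω) ^ n) P ∧ ∫ ω, (X t ω - X s ω) ^ n ∂P = mo c n (t-s) := by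
  have hid : IdentDistrib (fun ω => X t ω - X s ω) (X (t-s)) P P :=
    ⟨((hX.measurable t).sub (hX.measurable s)).aemeasurable, (hX.measurable _).aemeasurable,
      hX.stationary s t hs hst⟩
  have h2 := hid.comp (u := fun x : ℝ => x ^ n) (by fun_prop)
  refine ⟨(h2.integrable_iff).2 (pow_int hX hmom n _ (by linarith)), ?_⟩
  rw [← hm n (t-s) (by linarith)]
  exact h2.integral_eq

theorem cross (hX : IsLevy P X) (hmom : ∀ (n : ℕ) (t : ℝ), 0 ≤ t → Integrable (fun ω => |X t ω| ^ n) P)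
    (hm : ∀ (n : ℕ) (t : ℝ), 0 ≤ t → (∫ ω, (X t ω) ^ n ∂P) = mo c n t)
    (p : ℝ[X]) (n : ℕ) (s t : ℝ) (hs : 0 ≤ s) (hst : s ≤ t) :
    Integrable (fun ω => p.eval (X s ω) * (Pp c n t).eval (X t ω)) P ∧
    ∫ ω, p.eval (X s ω) * (Pp c n t).eval (X t ω) ∂P = Lf c s (p * Pp c n s) := by
  have exp : ∀ x y : ℝ, p.eval x * (Pp c n t).eval y = ∑ a ∈ Finset.range (n+1),
      (p * (C (n.choose a : ℝ) * Pp c (n-a) t)).eval x * (y - x) ^ a := by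
    intro x y
    rw [← taylor_eval_sub (r := x) (f := Pp c n t), eval_eq_sum_range' (p := taylor x (Pp c n t)) (n := n+1)
      (by rw [natDegree_taylor]; exact Nat.lt_succ_of_le (Pp_natDegree c n t)), Finset.mul_sum]
    refine Finset.sum_congr rfl fun a _ => ?_
    rw [taylor_coeff, Pp_hasse]; simp only [eval_mul]
    ring
  simp only [exp]
  have hind := indep_incr hX s t hs hst
  have hindp : ∀ (q : ℝ[X]) (a : ℕ), IndepFun (fun ω => q.eval (X s ω)) (fun ω => (X t ω - X s ω)^a) P := 
    fun q a => hind.comp (φ := fun x => q.eval x) (ψ := fun x => x ^ a) q.continuous.measurable (by fun_prop)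
  have hint : ∀ (q : ℝ[X]) (a : ℕ), Integrable (fun ω => q.eval (X s ω) * (X t ω - X s ω)^a) P :=
    fun q a => (hindp q a).integrable_mul (poly_int hX hmom q s hs) (incr_pow hX hmom hm a s t hs hst).1
  refine ⟨integrable_finsetSum _ fun a _ => hint _ a, ?_⟩
  rw [integral_finsetSum _ fun a _ => hint _ a]
  have e : p * Pp c n s = ∑ a ∈ Finset.range (n+1), 
      C (mo c a (t-s)) * (p * (C (n.choose a : ℝ) * Pp c (n-a) t)) := by
    have := Pp_shift c n t (t-s)
    rw [show t - (t-s) = s by ring] at this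
    rw [← this, Finset.mul_sum]
    refine Finset.sum_congr rfl fun a _ => ?_
    rw [C_mul]; ring
  rw [e, map_sum]
  refine Finset.sum_congr rfl fun a _ => ?_
  rw [(hindp _ a).integral_fun_mul_eq_mul_integral (poly_int hX hmom _ s hs).aestronglyMeasurable
    (incr_pow hX hmom hm a s t hs hst).1.aestronglyMeasurable, poly_integral hX hmom hm _ s hs,
    (incr_pow hX hmom hm a s t hs hst).2, Lf_C_mul, mul_comm]

theorem filtGE_le (hX : IsLevy P X) (t : ℝ) : filtGE X t ≤ (inferInstance : MeasurableSpace Ω) := by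
  unfold filtGE
  exact iSup₂_le fun u _ => (hX.measurable u).comap_le

theorem filtGE_meas (t : ℝ) : Measurable[filtGE X t] (X t) := by
  rw [measurable_iff_comap_le]
  unfold filtGE
  exact le_iSup₂_of_le t (Set.mem_Ici.2 le_rfl) le_rfl

theorem rev_eq (hX : IsLevy P X) (hmom : ∀ (n : ℕ) (t : ℝ), 0 ≤ t → Integrable (fun ω => |X t ω| ^ n) P)
    (hm : ∀ (n : ℕ) (t : ℝ), 0 ≤ t → (∫ ω, (X t ω) ^ n ∂P) = mo c n t) (k : ℕ) (μ : ℝ → ℝ)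
    (hrev : ∀ s t : ℝ, 0 < s → s < t →
      P[(fun ω => μ s * Mp c k (X s ω) s) | filtGE X t]
        =ᵐ[P] fun ω => μ t * Mp c k (X t ω) t)
    (n : ℕ) (s t : ℝ) (hs : 0 < s) (hst : s < t) :
    μ s * (Qp c n k).eval s = μ t * (Qp c n k).eval t := by
  have hr := hrev s t hs hst
  simp only [← Pp_eval] at hr
  obtain ⟨i1, e1⟩ := cross hX hmom hm (Pp c k s) n s t hs.le hst.le
  obtain ⟨i2, e2⟩ := cross hX hmom hm (Pp c k t) n t t (hs.trans hst).le le_rfl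
  have hg : StronglyMeasurable[filtGE X t] (fun ω => (Pp c n t).eval (X t ω)) :=
    ((Pp c n t).continuous.measurable.comp (filtGE_meas t)).stronglyMeasurable
  have i1' : Integrable ((fun ω => μ s * (Pp c k s).eval (X s ω)) * (fun ω => (Pp c n t).eval (X t ω))) P := by
    refine (i1.const_mul (μ s)).congr ?_
    filter_upwards with ω
    simp only [Pi.mul_apply]; ring
  have hp := condExp_mul_of_stronglyMeasurable_right hg i1' 
    ((poly_int hX hmom (Pp c k s) s hs.le).const_mul (μ s))
  have hI := integral_condExp (μ := P) (filtGE_le hX t) 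
    (f := (fun ω => μ s * (Pp c k s).eval (X s ω)) * (fun ω => (Pp c n t).eval (X t ω)))
  rw [integral_congr_ae hp] at hI
  have hp2 : (P[(fun ω => μ s * (Pp c k s).eval (X s ω)) | filtGE X t] * (fun ω => (Pp c n t).eval (X t ω)))
      =ᵐ[P] fun ω => μ t * ((Pp c k t).eval (X t ω) * (Pp c n t).eval (X t ω)) := by
    filter_upwards [hr] with ω hω
    simp only [Pi.mul_apply, hω]; ring
  rw [integral_congr_ae hp2] at hI
  simp only [Pi.mul_apply, mul_assoc] at hI
  rw [integral_const_mul, integral_const_mul, e1, e2] at hI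
  rw [Qp_eval, Qp_eval]
  exact hI.symm

end prob

end Stmt13

/-- If `k ≥ 2`, `c_2 > 0`, and `μ(t) M_k(X_t,t)` is a reversed
martingale for some nowhere-vanishing `μ`, then `c_j = 0` for
`max(3, k-1) ≤ j ≤ 2k-1`. -/
theorem stmt_13 {Ω : Type*} [MeasurableSpace Ω] (P : Measure Ω) [IsProbabilityMeasure P]
    (X : ℝ → Ω → ℝ) (c : ℕ → ℝ) (hX : IsLevy P X)
    (hmom : ∀ (n : ℕ) (t : ℝ), 0 ≤ t → Integrable (fun ω => |X t ω| ^ n) P)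
    (hm : ∀ (n : ℕ) (t : ℝ), 0 ≤ t → (∫ ω, (X t ω) ^ n ∂P) = mo c n t)
    (k : ℕ) (hk : 2 ≤ k) (hc2 : 0 < c 2)
    (μ : ℝ → ℝ) (hμ : ∀ t : ℝ, 0 < t → μ t ≠ 0)
    (hrev : ∀ s t : ℝ, 0 < s → s < t →
      P[(fun ω => μ s * Mp c k (X s ω) s) | filtGE X t]
        =ᵐ[P] fun ω => μ t * Mp c k (X t ω) t)
    (j : ℕ) (hj1 : max 3 (k - 1) ≤ j) (hj2 : j ≤ 2 * k - 1) :
    c j = 0 := by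
  exact Stmt13.algebra_main c hc2 k
    (fun n _ hn => Stmt13.poly_step c hc2 k μ hμ
      (fun n s t hs hst => Stmt13.rev_eq hX hmom hm k μ hrev n s t hs hst) n hn)
    j (by omega) hj2
end

section
/- Assume c_2 > 0. If the polynomial martingales are orthogonal, i.e. E[M_n(X_t,t) · M_k(X_t,t)] = 0 for all n ≠ k with n, k ≥ 1 and all t > 0, then c_i = 0 for all i ≥ 3 (so the process is a Wiener process with variance parameter c_2). -/
open MeasureTheory ProbabilityTheory Filter

/-- Exponential generating function of a sequence. -/
noncomputable def egfS (a : ℕ → ℝ) : PowerSeries ℝ :=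
  PowerSeries.mk (fun n => a n / (n.factorial : ℝ))

lemma egfS_mul_coeff (a b : ℕ → ℝ) (n : ℕ) :
    PowerSeries.coeff n (egfS a * egfS b) * (n.factorial : ℝ) =
      ∑ j ∈ Finset.range (n + 1), (n.choose j : ℝ) * a j * b (n - j) := by
  rw [PowerSeries.coeff_mul, Finset.Nat.sum_antidiagonal_eq_sum_range_succ_mk, Finset.sum_mul]
  refine Finset.sum_congr rfl fun j hj => ?_
  have hj' : j ≤ n := by simpa [Nat.lt_succ_iff] using hj
  have h := Nat.choose_mul_factorial_mul_factorial hj'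
  have h' : (n.choose j : ℝ) * j.factorial * (n - j).factorial = n.factorial := by
    exact_mod_cast h
  have h1 : (j.factorial : ℝ) ≠ 0 := by exact_mod_cast Nat.factorial_ne_zero _
  have h2 : ((n - j).factorial : ℝ) ≠ 0 := by exact_mod_cast Nat.factorial_ne_zero _
  simp only [egfS, PowerSeries.coeff_mk]
  rw [← h']
  field_simp

lemma egfS_deriv (a : ℕ → ℝ) :
    PowerSeries.derivative (R := ℝ) (egfS a) = egfS (fun n => a (n + 1)) := by
  ext n
  simp only [PowerSeries.coeff_derivative, egfS, PowerSeries.coeff_mk]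
  rw [Nat.factorial_succ]
  have h1 : (n.factorial : ℝ) ≠ 0 := by exact_mod_cast Nat.factorial_ne_zero _
  have h2 : (n : ℝ) + 1 ≠ 0 := by positivity
  push_cast
  field_simp

lemma egfS_mo_deriv (c : ℕ → ℝ) (t : ℝ) :
    egfS (fun n => mo c (n + 1) t) =
      PowerSeries.C t * (egfS (fun n => c (n + 1)) * egfS (fun n => mo c n t)) := by
  ext n
  have h1 : (n.factorial : ℝ) ≠ 0 := by exact_mod_cast Nat.factorial_ne_zero _
  apply mul_right_cancel₀ h1
  rw [PowerSeries.coeff_C_mul, mul_assoc, egfS_mul_coeff]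
  simp only [egfS, PowerSeries.coeff_mk]
  rw [div_mul_cancel₀ _ h1, mo]

lemma egfS_mo_inv (c : ℕ → ℝ) (t : ℝ) :
    egfS (fun n => mo c n t) * egfS (fun n => mo c n (-t)) = 1 := by
  apply PowerSeries.derivative.ext
  · rw [Derivation.leibniz, egfS_deriv, egfS_deriv, egfS_mo_deriv, egfS_mo_deriv]
    simp only [map_neg, smul_eq_mul, Derivation.map_one_eq_zero]
    ring
  · simp [egfS, mo]

lemma sum_one (c : ℕ → ℝ) (t : ℝ) (n : ℕ) (hn : n ≠ 0) :
    ∑ j ∈ Finset.range (n + 1), (n.choose j : ℝ) * mo c j t * mo c (n - j) (-t) = 0 := by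
  have h := egfS_mul_coeff (fun n => mo c n t) (fun n => mo c n (-t)) n
  rw [egfS_mo_inv] at h
  rw [← h]
  simp [PowerSeries.coeff_one, hn]

lemma sum_two (c : ℕ → ℝ) (t : ℝ) (n : ℕ) :
    ∑ j ∈ Finset.range (n + 1), (n.choose j : ℝ) * mo c (j + 1) t * mo c (n - j) (-t)
      = t * c (n + 1) := by
  have h := egfS_mul_coeff (fun n => mo c (n + 1) t) (fun n => mo c n (-t)) n
  rw [egfS_mo_deriv, mul_assoc, mul_assoc, egfS_mo_inv, mul_one] at h
  rw [← h, PowerSeries.coeff_C_mul]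
  have h1 : (n.factorial : ℝ) ≠ 0 := by exact_mod_cast Nat.factorial_ne_zero _
  simp only [egfS, PowerSeries.coeff_mk]
  field_simp

/-- If `c_2 > 0` and the polynomial martingales are orthogonal, i.e.
`E[M_n(X_t,t) M_k(X_t,t)] = 0` for all `n ≠ k` (`n,k ≥ 1`) and all `t > 0`, then
`c_i = 0` for all `i ≥ 3` (the process is a Wiener process with variance `c_2`). -/
theorem stmt_15 {Ω : Type*} [MeasurableSpace Ω] (P : Measure Ω) [IsProbabilityMeasure P]
    (X : ℝ → Ω → ℝ) (c : ℕ → ℝ) (hX : IsLevy P X)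
    (hmom : ∀ (n : ℕ) (t : ℝ), 0 ≤ t → Integrable (fun ω => |X t ω| ^ n) P)
    (hm : ∀ (n : ℕ) (t : ℝ), 0 ≤ t → (∫ ω, (X t ω) ^ n ∂P) = mo c n t)
    (hc2 : 0 < c 2)
    (horth : ∀ n k : ℕ, 1 ≤ n → 1 ≤ k → n ≠ k → ∀ t : ℝ, 0 < t →
      (∫ ω, Mp c n (X t ω) t * Mp c k (X t ω) t ∂P) = 0) :
    ∀ i : ℕ, 3 ≤ i → c i = 0 := by
  intro i hi
  obtain ⟨n, rfl⟩ : ∃ n, i = n + 1 := ⟨i - 1, by omega⟩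
  have h := horth n 1 (by omega) le_rfl (by omega) 1 one_pos
  have hint : ∀ k : ℕ, Integrable (fun ω => (X 1 ω) ^ k) P := by
    intro k
    refine (hmom k 1 zero_le_one).mono ((hX.measurable 1).pow_const k).aestronglyMeasurable ?_
    filter_upwards with ω
    simp
  have hM1 : ∀ x : ℝ, Mp c 1 x 1 = x - c 1 := by
    intro x
    simp [Mp, Finset.sum_range_succ, mo]
    ring
  have hexp : ∀ ω, Mp c n (X 1 ω) 1 * Mp c 1 (X 1 ω) 1 =
      (∑ j ∈ Finset.range (n + 1), ((n.choose j : ℝ) * mo c (n - j) (-1)) * (X 1 ω) ^ (j + 1))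
      - c 1 * ∑ j ∈ Finset.range (n + 1), ((n.choose j : ℝ) * mo c (n - j) (-1)) * (X 1 ω) ^ j := by
    intro ω
    rw [hM1, Mp, mul_sub, mul_comm (c 1), Finset.sum_mul]
    congr 1
    refine Finset.sum_congr rfl fun j _ => ?_
    ring
  simp_rw [hexp] at h
  rw [integral_sub, integral_const_mul, integral_finsetSum, integral_finsetSum] at h
  · simp_rw [integral_const_mul, hm _ 1 zero_le_one] at h
    have e1 := sum_one c 1 n (by omega)
    have e2 := sum_two c 1 n
    simp_rw [mul_right_comm _ (mo c _ (-1)), e1, e2] at h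
    linarith
  · exact fun j _ => (hint _).const_mul _
  · exact fun j _ => (hint _).const_mul _
  · exact integrable_finsetSum _ fun j _ => (hint _).const_mul _
  · exact (integrable_finsetSum _ fun j _ => (hint _).const_mul _).const_mul _
end
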